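/- arXiv:math/0610739 — 5 statements merged into one kernel-verified Lean document; each statement's English description precedes it below -/
import Mathlib

section
/- Let p be a prime, α ≥ 1 an integer, and χ a primitive Dirichlet character mod p^α. If a is an integer divisible by p, then C_χ(a) = 0. -/
open scoped BigOperators

/-- `e(x) = exp(2πix)`. -/
noncomputable def e (x : ℝ) : ℂ := Complex.exp (2 * (Real.pi : ℂ) * Complex.I * (x : ℂ))

/-- The cubic character sum `C_χ(a) = ∑_{k=1}^{q} χ(k) e(a k³ / q)` for a Dirichlet
character `χ` mod `q`. -/
noncomputable def Cchi {q : ℕ} (χ : DirichletCharacter ℂ q) (a : ℤ) : ℂ :=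
  ∑ k ∈ Finset.Icc 1 q, χ (k : ZMod q) * e ((a : ℝ) * (k : ℝ) ^ 3 / (q : ℝ))

/-- Summing over `1, …, n` a function of the residue class is summing over `ZMod n`. -/
lemma sum_Icc_natCast_zmod {M : Type*} [AddCommMonoid M] (n : ℕ) [NeZero n] (f : ZMod n → M) :
    ∑ k ∈ Finset.Icc 1 n, f (k : ZMod n) = ∑ x, f x := by
  refine Finset.sum_nbij (fun k : ℕ ↦ (k : ZMod n)) (by simp) ?_ ?_ (by simp)
  · intro k hk l hl h
    simp only [Finset.coe_Icc, Set.mem_Icc] at hk hl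
    have h' : ((k : ℤ) : ZMod n) = ((l : ℤ) : ZMod n) := by exact_mod_cast h
    have hdvd := (ZMod.intCast_eq_intCast_iff_dvd_sub _ _ _).mp h'
    have := Int.eq_zero_of_abs_lt_dvd hdvd (by rw [abs_lt]; omega)
    omega
  · intro x _
    have hn := NeZero.pos n
    by_cases hx : x = 0
    · exact ⟨n, by simp only [Finset.coe_Icc, Set.mem_Icc]; omega, by simp [hx]⟩
    · have hv : x.val ≠ 0 := (ZMod.val_ne_zero x).mpr hx
      have := x.val_lt
      exact ⟨x.val, by simp only [Finset.coe_Icc, Set.mem_Icc]; omega, by simp⟩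

lemma Cchi_eq_sum_zmod {q : ℕ} [NeZero q] (χ : DirichletCharacter ℂ q) (a : ℤ) :
    Cchi χ a = ∑ x : ZMod q, χ x * ZMod.stdAddChar ((a : ZMod q) * x ^ 3) := by
  rw [← sum_Icc_natCast_zmod q (fun x ↦ χ x * ZMod.stdAddChar ((a : ZMod q) * x ^ 3)), Cchi]
  refine Finset.sum_congr rfl fun k _ ↦ ?_
  have h : (a : ZMod q) * (k : ZMod q) ^ 3 = ((a * (k : ℤ) ^ 3 : ℤ) : ZMod q) := by push_cast; rfl
  rw [h, ZMod.stdAddChar_coe, e]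
  congr 2
  push_cast
  ring

/-- A primitive character is nontrivial on the kernel of reduction modulo a proper divisor. -/
lemma exists_unitsMap_eq_one_of_isPrimitive {R : Type*} [CommMonoidWithZero R] {n d : ℕ}
    [NeZero n]
    {χ : DirichletCharacter R n} (hχ : χ.IsPrimitive) (hd : d ∣ n) (hlt : d < n) :
    ∃ u : (ZMod n)ˣ, ZMod.unitsMap hd u = 1 ∧ χ u ≠ 1 := by
  by_contra! h
  have hf : χ.FactorsThrough d := by
    rw [DirichletCharacter.factorsThrough_iff_ker_unitsMap hd]
    intro u hu
    rw [MonoidHom.mem_ker] at hu ⊢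
    ext
    simpa using h u hu
  have hle : χ.conductor ≤ d := Nat.sInf_le hf
  rw [hχ] at hle
  omega

lemma intCast_mul_eq_of_unitsMap_eq_one {n d : ℕ} (hd : d ∣ n) {a : ℤ} (ha : (n : ℤ) ∣ a * d)
    {u : (ZMod n)ˣ} (hu : ZMod.unitsMap hd u = 1) : (a : ZMod n) * u = a := by
  obtain ⟨m, hm⟩ := ZMod.intCast_surjective (u : ZMod n)
  have h1 : ((m : ℤ) : ZMod d) = 1 := by
    have := congrArg Units.val hu
    rwa [ZMod.unitsMap_val, ← hm, ZMod.cast_intCast hd, Units.val_one] at this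
  have h2 : (d : ℤ) ∣ m - 1 := by
    rw [← ZMod.intCast_zmod_eq_zero_iff_dvd]
    simp [h1]
  have h3 : ((a * (m - 1) : ℤ) : ZMod n) = 0 :=
    (ZMod.intCast_zmod_eq_zero_iff_dvd _ _).mpr (ha.trans (mul_dvd_mul_left a h2))
  push_cast at h3
  rw [← hm]
  linear_combination h3

/-- If `χ` is a primitive Dirichlet character mod `p^α` with `p` prime, `α ≥ 1`,
and `p ∣ a`, then `C_χ(a) = 0`. -/
theorem Cchi_eq_zero_of_primitive_of_dvd (p : ℕ) (hp : p.Prime) (α : ℕ) (hα : 1 ≤ α)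
    (χ : DirichletCharacter ℂ (p ^ α)) (hχ : χ.IsPrimitive)
    (a : ℤ) (hpa : (p : ℤ) ∣ a) :
    Cchi χ a = 0 := by
  have : NeZero (p ^ α) := ⟨pow_ne_zero _ hp.ne_zero⟩
  have hd : p ^ (α - 1) ∣ p ^ α := pow_dvd_pow _ (Nat.sub_le _ _)
  have hlt : p ^ (α - 1) < p ^ α := Nat.pow_lt_pow_right hp.one_lt (by omega)
  obtain ⟨u, hu, hχu⟩ := exists_unitsMap_eq_one_of_isPrimitive hχ hd hlt
  have hdvd : ((p ^ α : ℕ) : ℤ) ∣ a * (p ^ (α - 1) : ℕ) := by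
    have h := mul_dvd_mul_right hpa ((p : ℤ) ^ (α - 1))
    rw [mul_pow_sub_one (by omega)] at h
    exact_mod_cast h
  have hau := intCast_mul_eq_of_unitsMap_eq_one hd hdvd hu
  have hau3 (x : ZMod (p ^ α)) : (a : ZMod (p ^ α)) * (u * x) ^ 3 = a * x ^ 3 := by
    linear_combination ((u : ZMod (p ^ α)) ^ 2 + u + 1) * x ^ 3 * hau
  have hsum : χ u * Cchi χ a = Cchi χ a := by
    rw [Cchi_eq_sum_zmod, Finset.mul_sum]
    refine Fintype.sum_equiv (Units.mulLeft u) _ _ fun x ↦ ?_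
    rw [Units.mulLeft_apply, hau3, map_mul χ, mul_assoc]
  by_contra h0
  exact hχu ((mul_eq_right₀ h0).mp hsum)
end

section
/- Let a₁,…,a₉ be nonzero integers and n an integer with (aᵢ,aⱼ)=1 for 1≤i<j≤9 and (n,a₁,…,a₉)=1. Then A(p^α) = 0 for every prime p ≠ 3 and every integer α ≥ 2, and A(3^α) = 0 for every integer α ≥ 4. -/
open scoped BigOperators Classical

/-- The cubic Ramanujan-type sum `C_q(a) = ∑_{1 ≤ h ≤ q, (h,q)=1} e(a h³ / q)`. -/
noncomputable def Cq (q : ℕ) (a : ℤ) : ℂ :=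
  ∑ h ∈ Finset.filter (fun h => Nat.gcd h q = 1) (Finset.Icc 1 q),
    e ((a : ℝ) * (h : ℝ) ^ 3 / (q : ℝ))

/-- `A(q) = φ(q)^{-9} ∑_{1 ≤ k ≤ q, (k,q)=1} e(-kn/q) ∏_{j=1}^9 C_q(a_j k)`;
note `A(1) = 1`. -/
noncomputable def Aq (a : Fin 9 → ℤ) (n : ℤ) (q : ℕ) : ℂ :=
  (1 / ((Nat.totient q : ℂ)) ^ 9) *
    ∑ k ∈ Finset.filter (fun k => Nat.gcd k q = 1) (Finset.Icc 1 q),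
      e (-((n : ℝ) * (k : ℝ)) / (q : ℝ)) * ∏ j, Cq q (a j * k)

theorem e_div_eq_stdAddChar (q : ℕ) [NeZero q] (j : ℤ) :
    e ((j : ℝ) / (q : ℝ)) = ZMod.stdAddChar (j : ZMod q) := by
  rw [ZMod.stdAddChar_coe, e]
  push_cast
  congr 1
  ring

/-- The sum `C_q(a)` as a sum over the units of `ℤ/qℤ`. -/
theorem Cq_eq_sum_zmod (q : ℕ) [NeZero q] (a : ℤ) :
    Cq q a = ∑ x : ZMod q with IsUnit x, ZMod.stdAddChar ((a : ZMod q) * x ^ 3) := by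
  unfold Cq
  have hq : 0 < q := Nat.pos_of_ne_zero (NeZero.ne q)
  refine Finset.sum_bij (fun h _ => (h : ZMod q)) ?_ ?_ ?_ ?_
  · intro h hh
    simp only [Finset.mem_filter, Finset.mem_univ, true_and] at hh ⊢
    exact (ZMod.isUnit_iff_coprime h q).2 hh.2
  · intro h₁ hh₁ h₂ hh₂ heq
    simp only [Finset.mem_filter, Finset.mem_Icc] at hh₁ hh₂
    have hmod := (ZMod.natCast_eq_natCast_iff _ _ _).1 heq
    obtain ⟨c, hc⟩ := Nat.modEq_iff_dvd.1 hmod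
    have hzero : (q : ℤ) * c = 0 :=
      Int.eq_zero_of_abs_lt_dvd (m := q) ⟨c, rfl⟩ (by rw [← hc, abs_lt]; lia)
    lia
  · intro x hx
    simp only [Finset.mem_filter, Finset.mem_univ, true_and] at hx
    by_cases hx0 : x.val = 0
    · refine ⟨q, ?_, ?_⟩
      · have hx' : IsUnit ((q : ℕ) : ZMod q) := by
          rwa [ZMod.natCast_self, ← (ZMod.val_eq_zero x).1 hx0]
        simp only [Finset.mem_filter, Finset.mem_Icc]
        exact ⟨⟨hq, le_rfl⟩, (ZMod.isUnit_iff_coprime q q).1 hx'⟩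
      · rw [ZMod.natCast_self, (ZMod.val_eq_zero x).1 hx0]
    · refine ⟨x.val, ?_, ZMod.natCast_zmod_val x⟩
      simp only [Finset.mem_filter, Finset.mem_Icc]
      refine ⟨⟨Nat.pos_of_ne_zero hx0, (ZMod.val_lt x).le⟩, ?_⟩
      exact (ZMod.isUnit_iff_coprime x.val q).1 (by rwa [ZMod.natCast_zmod_val])
  · intro h _
    have := e_div_eq_stdAddChar q (a * (h : ℤ) ^ 3)
    push_cast at this
    exact this

theorem stdAddChar_geom_sum_eq_zero (q : ℕ) [NeZero q] {y : ZMod q} (hy : y ≠ 0) :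
    ∑ t ∈ Finset.range q, ZMod.stdAddChar ((t : ZMod q) * y) = 0 := by
  have hpow (t : ℕ) : ZMod.stdAddChar ((t : ZMod q) * y) = ZMod.stdAddChar y ^ t := by
    rw [← nsmul_eq_mul, AddChar.map_nsmul_eq_pow]
  have hne : ZMod.stdAddChar y ≠ 1 := fun h =>
    hy (ZMod.injective_stdAddChar (h.trans (AddChar.map_zero_eq_one _).symm))
  simp_rw [hpow]
  rw [geom_sum_eq hne, ← hpow, ZMod.natCast_self, zero_mul, AddChar.map_zero_eq_one, sub_self,
    zero_div]

/-- `C_q(b)` vanishes for `b` prime to `q` as soon as cubing is affine, but not constant, along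
shifts by multiples of some `d`. -/
theorem Cq_eq_zero_of_shift (q : ℕ) [NeZero q] (b : ℤ) (hb : IsUnit (b : ZMod q)) (d : ZMod q)
    (h3d : 3 * d ≠ 0) (hd2 : 3 * d ^ 2 = 0) (hd3 : d ^ 3 = 0) : Cq q b = 0 := by
  have hunit (t x : ZMod q) : IsUnit (x + t * d) ↔ IsUnit x := by
    have hnil : IsNilpotent (t * d) := ⟨3, by rw [mul_pow, hd3, mul_zero]⟩
    refine ⟨fun h => ?_, fun h => hnil.isUnit_add_left_of_commute h (Commute.all _ _)⟩
    simpa using hnil.neg.isUnit_add_left_of_commute h (Commute.all _ _)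
  have hcube (t x : ZMod q) : b * (x + t * d) ^ 3 = b * x ^ 3 + t * (b * x ^ 2 * (3 * d)) := by
    linear_combination (b * x * t ^ 2) * hd2 + (b * t ^ 3) * hd3
  have hshift (t : ZMod q) : Cq q b = ∑ x : ZMod q with IsUnit x,
      ZMod.stdAddChar ((b : ZMod q) * x ^ 3) *
        ZMod.stdAddChar (t * ((b : ZMod q) * x ^ 2 * (3 * d))) := by
    rw [Cq_eq_sum_zmod, Finset.sum_filter, Finset.sum_filter,
      ← Equiv.sum_comp (Equiv.addRight (t * d))]
    refine Finset.sum_congr rfl fun x _ => ?_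
    simp only [Equiv.coe_addRight, hunit, hcube, AddChar.map_add_eq_mul]
  have hsum : (q : ℂ) * Cq q b = 0 := by
    calc (q : ℂ) * Cq q b = ∑ _t ∈ Finset.range q, Cq q b := by simp
      _ = ∑ t ∈ Finset.range q, ∑ x : ZMod q with IsUnit x,
          ZMod.stdAddChar ((b : ZMod q) * x ^ 3) *
            ZMod.stdAddChar ((t : ZMod q) * ((b : ZMod q) * x ^ 2 * (3 * d))) :=
        Finset.sum_congr rfl fun t _ => hshift t
      _ = 0 := by
        rw [Finset.sum_comm]
        refine Finset.sum_eq_zero fun x hx => ?_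
        have hx' : IsUnit x := (Finset.mem_filter.1 hx).2
        rw [← Finset.mul_sum, stdAddChar_geom_sum_eq_zero, mul_zero]
        exact fun h => h3d ((hb.mul (hx'.pow 2)).mul_right_eq_zero.1 h)
  exact (mul_eq_zero.1 hsum).resolve_left (Nat.cast_ne_zero.2 (NeZero.ne q))

theorem Cq_prime_pow_eq_zero {p α : ℕ} (hp : p.Prime) (hp3 : p ≠ 3) (hα : 2 ≤ α) {b : ℤ}
    (hb : IsUnit (b : ZMod (p ^ α))) : Cq (p ^ α) b = 0 := by
  have : NeZero (p ^ α) := ⟨pow_ne_zero _ hp.ne_zero⟩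
  have hd2 : ((p ^ (α - 1) : ℕ) : ZMod (p ^ α)) ^ 2 = 0 := by
    rw [← Nat.cast_pow, ZMod.natCast_eq_zero_iff, ← pow_mul]
    exact pow_dvd_pow p (by lia)
  refine Cq_eq_zero_of_shift _ b hb ((p ^ (α - 1) : ℕ) : ZMod (p ^ α)) ?_ ?_ ?_
  · intro h
    have h' : ((3 * p ^ (α - 1) : ℕ) : ZMod (p ^ α)) = 0 := by
      rw [Nat.cast_mul]
      exact_mod_cast h
    rw [ZMod.natCast_eq_zero_iff, ← Nat.sub_add_cancel (by lia : 1 ≤ α), pow_succ',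
      Nat.add_sub_cancel] at h'
    have := Nat.dvd_of_mul_dvd_mul_right (pow_pos hp.pos _) h'
    exact hp3 ((Nat.prime_dvd_prime_iff_eq hp Nat.prime_three).1 this)
  · rw [hd2, mul_zero]
  · rw [pow_succ, hd2, zero_mul]

theorem Cq_three_pow_eq_zero {α : ℕ} (hα : 3 ≤ α) {b : ℤ}
    (hb : IsUnit (b : ZMod (3 ^ α))) : Cq (3 ^ α) b = 0 := by
  have : NeZero (3 ^ α) := ⟨pow_ne_zero _ three_ne_zero⟩
  have hpow (k : ℕ) : (3 : ZMod (3 ^ α)) ^ k = 0 ↔ α ≤ k := by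
    have := ZMod.natCast_eq_zero_iff (3 ^ k) (3 ^ α)
    rw [Nat.pow_dvd_pow_iff_le_right (by norm_num)] at this
    exact_mod_cast this
  refine Cq_eq_zero_of_shift _ b hb (3 ^ (α - 2)) ?_ ?_ ?_
  · rw [← pow_succ', Ne, hpow]
    lia
  · rw [← pow_mul, ← pow_succ', hpow]
    lia
  · rw [← pow_mul, hpow]
    lia

/-- `A(p^α) = 0` whenever every `C_{p^α}(b)` with `b` prime to `p` vanishes. -/
theorem Aq_prime_pow_eq_zero_of_Cq {p α : ℕ} (hp : p.Prime) (a : Fin 9 → ℤ) (n : ℤ)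
    (hcop : ∀ i j, i ≠ j → IsCoprime (a i) (a j))
    (hC : ∀ b : ℤ, IsUnit (b : ZMod (p ^ α)) → Cq (p ^ α) b = 0) : Aq a n (p ^ α) = 0 := by
  obtain ⟨j, hj⟩ : ∃ j, ¬ (p : ℤ) ∣ a j := by
    by_contra! h
    exact (Nat.prime_iff_prime_int.1 hp).not_isUnit
      ((hcop 0 1 (by decide)).isUnit_of_dvd' (h 0) (h 1))
  have haj : IsUnit (a j : ZMod (p ^ α)) := by
    rw [ZMod.coe_int_isUnit_iff_isCoprime, Nat.cast_pow]
    exact ((Nat.prime_iff_prime_int.1 hp).coprime_iff_not_dvd.2 hj).pow_left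
  rw [Aq, Finset.sum_eq_zero, mul_zero]
  intro k hk
  have hk' : IsUnit (k : ZMod (p ^ α)) :=
    (ZMod.isUnit_iff_coprime k _).2 (Finset.mem_filter.1 hk).2
  rw [Finset.prod_eq_zero (Finset.mem_univ j), mul_zero]
  refine hC _ ?_
  push_cast
  exact haj.mul hk'

/-- Under the coprimality conditions, `A(p^α) = 0` for every prime `p ≠ 3` and `α ≥ 2`,
and `A(3^α) = 0` for `α ≥ 4`. -/
theorem Aq_prime_pow_eq_zero (a : Fin 9 → ℤ) (ha : ∀ j, a j ≠ 0) (n : ℤ)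
    (hcop : ∀ i j, i ≠ j → IsCoprime (a i) (a j))
    (hn : ∀ d : ℤ, d ∣ n → (∀ j, d ∣ a j) → IsUnit d) :
    (∀ p : ℕ, p.Prime → p ≠ 3 → ∀ α : ℕ, 2 ≤ α → Aq a n (p ^ α) = 0) ∧
    (∀ α : ℕ, 4 ≤ α → Aq a n (3 ^ α) = 0) := by
  exact ⟨fun p hp hp3 α hα => Aq_prime_pow_eq_zero_of_Cq hp a n hcop fun _ hb =>
      Cq_prime_pow_eq_zero hp hp3 hα hb,
    fun α hα => Aq_prime_pow_eq_zero_of_Cq Nat.prime_three a n hcop fun _ hb =>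
      Cq_three_pow_eq_zero (by lia) hb⟩
end

section
/- Let a₁,…,a₉ be nonzero integers and n an integer with (aᵢ,aⱼ)=1 for 1≤i<j≤9 and (n,a₁,…,a₉)=1. Then for every prime p ≠ 3 and every integer η ≥ 1, p^η·φ(p^η)^{−9}·N(p^η) = p·φ(p)^{−9}·N(p); and for every integer η ≥ 3, 3^η·φ(3^η)^{−9}·N(3^η) = 3³·φ(3³)^{−9}·N(3³). -/
open scoped BigOperators Classical

/-- `N(q) = #{(h₁,…,h₉) : 1 ≤ h_j ≤ q, (h_j,q)=1, a₁h₁³+⋯+a₉h₉³ ≡ n (mod q)}`. -/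
noncomputable def Ncount (a : Fin 9 → ℤ) (n : ℤ) (q : ℕ) : ℕ :=
  (Finset.filter
    (fun h : Fin 9 → ℕ => (∀ j, Nat.gcd (h j) q = 1) ∧
      (∑ j, a j * (h j : ℤ) ^ 3) ≡ n [ZMOD (q : ℤ)])
    (Finset.Icc 1 fun _ => q)).card

/-- The solutions in units of the diagonal equation `∑ j, a j * u j ^ m = c` over `R`. -/
def unitSolutions {ι R : Type*} [Fintype ι] [CommRing R] (m : ℕ) (a : ι → R) (c : R) :
    Set (ι → Rˣ) :=
  {u | ∑ j, a j * (u j : R) ^ m = c}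

theorem MonoidHom.natCard_preimage_of_surjective {G H : Type*} [Group G] [Group H]
    (f : G →* H) (hf : Function.Surjective f) (S : Set H) :
    Nat.card (f ⁻¹' S) = Nat.card f.ker * Nat.card S := by
  have e : (f ⁻¹' S) ≃ (Σ _ : S, f.ker) :=
    (Equiv.sigmaFiberEquiv fun x : f ⁻¹' S => (⟨f x.1, x.2⟩ : S)).symm.trans
      (Equiv.sigmaCongrRight fun s =>
        ({ toFun := fun x => ⟨x.1.1, congrArg Subtype.val x.2⟩
           invFun := fun x => ⟨⟨x.1, by
             have : f x.1 = s := x.2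
             simp [this]⟩, Subtype.ext x.2⟩
           left_inv := fun _ => rfl
           right_inv := fun _ => rfl } : _ ≃ (f ⁻¹' {(s : H)})).trans
        (f.fiberEquivKerOfSurjective hf s))
  rw [Nat.card_congr (e.trans (Equiv.sigmaEquivProd _ _)), Nat.card_prod, mul_comm]

theorem MonoidHom.natCard_ker_compLeft {G H ι : Type*} [Group G] [Group H] [Fintype ι]
    (f : G →* H) : Nat.card (f.compLeft ι).ker = Nat.card f.ker ^ Fintype.card ι := by
  rw [← Nat.card_eq_fintype_card, ← Nat.card_fun]
  exact Nat.card_congr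
    ((Equiv.subtypeEquivRight fun x => by simp [MonoidHom.mem_ker, funext_iff]).trans
      (Equiv.subtypePiEquivPi (p := fun (_ : ι) g => g ∈ f.ker)))

/-- If every unit of `R` reducing to `1` in `R'` is an `m`-th power and some coefficient is a unit,
then the solutions of a diagonal equation of degree `m` in units equidistribute over those in
`R'`. -/
theorem natCard_unitSolutions_mul_natCard_ker {ι R R' : Type*} [Fintype ι] [CommRing R]
    [CommRing R'] [Finite R] (f : R →+* R') [IsLocalHom f]
    (hf : Function.Surjective (Units.map (f : R →* R'))) (m : ℕ)
    (hpow : ∀ x ∈ (Units.map (f : R →* R')).ker, ∃ y : Rˣ, y ^ m = x)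
    (a : ι → R) (c : R) (i : ι) (hi : IsUnit (a i)) :
    Nat.card (unitSolutions m a c) * Nat.card (Units.map (f : R →* R')).ker =
      Nat.card (Units.map (f : R →* R')).ker ^ Fintype.card ι *
        Nat.card (unitSolutions m (fun j => f (a j)) (f c)) := by
  classical
  set φ := Units.map (f : R →* R') with hφ
  have hsurj : Function.Surjective (φ.compLeft ι) := fun v =>
    ⟨fun j => (hf (v j)).choose, funext fun j => (hf (v j)).choose_spec⟩
  rw [← φ.natCard_ker_compLeft, ← MonoidHom.natCard_preimage_of_surjective _ hsurj,
    ← Nat.card_prod]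
  choose! ρ hρ using hpow
  have hsplit (b : ι → R) (v : ι → Rˣ) : ∑ j, b j * (v j : R) ^ m =
      b i * (v i : R) ^ m + ∑ j ∈ Finset.univ.erase i, b j * (v j : R) ^ m :=
    (Finset.add_sum_erase _ _ (Finset.mem_univ i)).symm
  have hrest (v : ι → Rˣ) (w : Rˣ) :
      ∑ j ∈ Finset.univ.erase i, a j * (Function.update v i w j : R) ^ m =
        ∑ j ∈ Finset.univ.erase i, a j * (v j : R) ^ m :=
    Finset.sum_congr rfl fun j hj => by
      rw [Function.update_of_ne (Finset.ne_of_mem_erase hj)]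
  have hmem (v : ι → Rˣ) :
      v ∈ φ.compLeft ι ⁻¹' unitSolutions m (fun j => f (a j)) (f c) ↔
        f (∑ j, a j * (v j : R) ^ m) = f c := by
    simp [unitSolutions, hφ]
  have hker {x : Rˣ} (hx : x ∈ φ.ker) : f (x : R) = 1 := by
    simpa [hφ] using congrArg Units.val (MonoidHom.mem_ker.mp hx)
  refine Nat.card_congr (Equiv.ofBijective
    (fun z => ⟨Function.update z.1.1 i (z.1.1 i * (ρ z.2.1)⁻¹), ?_⟩) ⟨?_, ?_⟩)
  · obtain ⟨⟨u, hu⟩, ⟨x, hx⟩⟩ := z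
    have hx' : f ((ρ x)⁻¹ : Rˣ) ^ m = 1 := by
      rw [← map_pow, ← Units.val_pow_eq_pow_val, inv_pow, hρ x hx]
      exact hker (inv_mem hx)
    have hu' : ∑ j, a j * (u j : R) ^ m = c := hu
    rw [hsplit] at hu'
    rw [hmem, hsplit, hrest]
    simpa [mul_pow, hx'] using congrArg f hu'
  · rintro ⟨⟨u, hu⟩, ⟨x, hx⟩⟩ ⟨⟨v, hv⟩, ⟨y, hy⟩⟩ h
    have h' := congrFun (congrArg Subtype.val h)
    have hoff (j : ι) (hj : j ≠ i) : u j = v j := by simpa [hj] using h' j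
    have hon : u i * (ρ x)⁻¹ = v i * (ρ y)⁻¹ := by simpa using h' i
    have hrest' : ∑ j ∈ Finset.univ.erase i, a j * (u j : R) ^ m =
        ∑ j ∈ Finset.univ.erase i, a j * (v j : R) ^ m :=
      Finset.sum_congr rfl fun j hj => by rw [hoff j (Finset.ne_of_mem_erase hj)]
    have hpowi : u i ^ m = v i ^ m := by
      have hc := (show _ = c from hu).trans (show _ = c from hv).symm
      rw [hsplit, hsplit a v, hrest', add_left_inj] at hc
      exact Units.ext (by simpa using hi.mul_left_cancel hc)
    have hxy : x = y := by
      have := congrArg (· ^ m) hon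
      simpa [mul_pow, hpowi, hρ x hx, hρ y hy] using this
    subst hxy
    have huv : u = v := by
      funext j
      by_cases hj : j = i
      · subst hj; exact mul_right_cancel hon
      · exact hoff j hj
    subst huv
    rfl
  · rintro ⟨v, hv⟩
    rw [hmem, hsplit, map_add, ← eq_sub_iff_add_eq, ← map_sub] at hv
    obtain ⟨α, hα⟩ := hi
    rw [← hα, ← Units.val_pow_eq_pow_val, ← Units.val_mul] at hv
    have hunit : IsUnit (c - ∑ j ∈ Finset.univ.erase i, a j * (v j : R) ^ m) :=
      isUnit_of_map_unit f _ (hv ▸ (Units.isUnit _).map f)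
    obtain ⟨w, hw⟩ := hunit
    rw [← hw] at hv
    have hx : (α * v i ^ m)⁻¹ * w ∈ φ.ker := by
      rw [MonoidHom.mem_ker, map_mul, map_inv, inv_mul_eq_one]
      exact Units.ext hv
    refine ⟨⟨⟨Function.update v i (v i * ρ ((α * v i ^ m)⁻¹ * w)), ?_⟩, ⟨_, hx⟩⟩, ?_⟩
    · change ∑ j, _ = c
      rw [hsplit, hrest, Function.update_self, ← eq_sub_iff_add_eq, ← hw, ← hα,
        ← Units.val_pow_eq_pow_val, ← Units.val_mul, mul_pow, hρ _ hx]
      congr 1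
      group
    · simp

theorem Ncount_eq_natCard_unitSolutions (a : Fin 9 → ℤ) (n : ℤ) {q : ℕ} (hq : 1 < q) :
    Ncount a n q = Nat.card (unitSolutions 3 (fun j => (a j : ZMod q)) n) := by
  have : NeZero q := ⟨by omega⟩
  have hlt {x : ℕ} (hx : x ≤ q) (hc : Nat.gcd x q = 1) : x < q :=
    lt_of_le_of_ne hx fun h => by rw [h, Nat.gcd_self] at hc; omega
  rw [Nat.card_coe_set_eq, Set.ncard_eq_toFinset_card', Ncount]
  refine Finset.card_bij
    (fun h hh j => ZMod.unitOfCoprime (h j) ((Finset.mem_filter.mp hh).2.1 j)) ?_ ?_ ?_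
  · intro h hh
    rw [Set.mem_toFinset]
    change ∑ j, _ = _
    simpa using (ZMod.intCast_eq_intCast_iff _ _ _).mpr (Finset.mem_filter.mp hh).2.2
  · intro h hh h' hh' heq
    rw [Finset.mem_filter, Finset.mem_Icc] at hh hh'
    funext j
    have := congrArg Units.val (congrFun heq j)
    simp only [ZMod.coe_unitOfCoprime] at this
    rw [ZMod.natCast_eq_natCast_iff] at this
    exact this.eq_of_lt_of_lt (hlt (hh.1.2 j) (hh.2.1 j)) (hlt (hh'.1.2 j) (hh'.2.1 j))
  · intro u hu
    rw [Set.mem_toFinset] at hu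
    refine ⟨fun j => (u j : ZMod q).val, ?_, ?_⟩
    · rw [Finset.mem_filter, Finset.mem_Icc]
      refine ⟨⟨fun j => ?_, fun j => (ZMod.val_lt _).le⟩, fun j => ZMod.val_coe_unit_coprime _, ?_⟩
      · have hc := ZMod.val_coe_unit_coprime (u j)
        refine Nat.one_le_iff_ne_zero.mpr fun h0 => ?_
        rw [show (u j : ZMod q).val = 0 from h0, Nat.coprime_zero_left] at hc
        omega
      · rw [← ZMod.intCast_eq_intCast_iff]
        simpa using (show _ = _ from hu)
    · funext j
      ext
      simp

theorem exists_pow_three_sub_dvd {p k : ℕ} (hp : p.Prime) (hk : 1 ≤ k) (h3 : p = 3 → 2 ≤ k)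
    {x : ℤ} (hx : (p : ℤ) ^ k ∣ x - 1) : ∃ y : ℤ, (p : ℤ) ^ (k + 1) ∣ y ^ 3 - x := by
  obtain ⟨t, ht⟩ := hx
  obtain rfl : x = 1 + p ^ k * t := by linarith
  by_cases hp3 : p = 3
  · subst hp3
    obtain ⟨l, rfl⟩ := Nat.exists_eq_add_of_le (h3 rfl)
    exact ⟨1 + 3 ^ (l + 1) * t, 3 ^ l * t ^ 2 + 3 ^ (2 * l) * t ^ 3, by push_cast; ring⟩
  · obtain ⟨l, rfl⟩ := Nat.exists_eq_add_of_le hk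
    have hcop : IsCoprime (3 : ℤ) p := by
      exact_mod_cast Nat.isCoprime_iff_coprime.mpr
        ((Nat.coprime_primes Nat.prime_three hp).mpr (Ne.symm hp3))
    obtain ⟨r, s, hrs⟩ := hcop
    refine ⟨1 + p ^ (1 + l) * (r * t),
      -(s * t) + 3 * p ^ l * (r * t) ^ 2 + p ^ (2 * l + 1) * (r * t) ^ 3, ?_⟩
    linear_combination (p : ℤ) ^ (1 + l) * t * hrs

theorem totient_prime_pow_succ_eq_mul {p k : ℕ} (hp : p.Prime) (hk : 1 ≤ k) :
    Nat.totient (p ^ (k + 1)) = p * Nat.totient (p ^ k) := by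
  rw [pow_succ', Nat.totient_mul_of_prime_of_dvd hp (dvd_pow_self p (Nat.ne_zero_of_lt hk))]

theorem Ncount_prime_pow_succ (a : Fin 9 → ℤ) (n : ℤ) (hcop : IsCoprime (a 0) (a 1))
    {p k : ℕ} (hp : p.Prime) (hk : 1 ≤ k) (h3 : p = 3 → 2 ≤ k) :
    Ncount a n (p ^ (k + 1)) = p ^ 8 * Ncount a n (p ^ k) := by
  have hdvd : p ^ k ∣ p ^ (k + 1) := pow_dvd_pow p k.le_succ
  have : NeZero (p ^ (k + 1)) := ⟨pow_ne_zero _ hp.ne_zero⟩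
  have : NeZero (p ^ k) := ⟨pow_ne_zero _ hp.ne_zero⟩
  have hlocal : IsLocalHom (ZMod.castHom hdvd (ZMod (p ^ k))) := by
    refine ⟨fun x hx => ?_⟩
    obtain ⟨x, rfl⟩ := ZMod.natCast_zmod_surjective x
    rw [map_natCast, ZMod.isUnit_iff_coprime, Nat.coprime_pow_right_iff (by omega)] at hx
    rw [ZMod.isUnit_iff_coprime]
    exact hx.pow_right _
  have hsurj := ZMod.unitsMap_surjective hdvd
  have hcard : Nat.card (ZMod.unitsMap hdvd).ker = p := by
    have h := MonoidHom.natCard_preimage_of_surjective _ hsurj Set.univ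
    rw [Set.preimage_univ, Nat.card_univ, Nat.card_univ, Nat.card_eq_fintype_card,
      Nat.card_eq_fintype_card (α := (ZMod (p ^ k))ˣ), ZMod.card_units_eq_totient,
      ZMod.card_units_eq_totient, totient_prime_pow_succ_eq_mul hp hk] at h
    exact (Nat.eq_of_mul_eq_mul_right (Nat.totient_pos.mpr (pow_pos hp.pos k)) h).symm
  obtain ⟨i, hi⟩ : ∃ i, ¬ (p : ℤ) ∣ a i := by
    by_contra! h
    exact (Nat.prime_iff_prime_int.mp hp).not_isUnit (hcop.isUnit_of_dvd' (h 0) (h 1))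
  have hunit : IsUnit (a i : ZMod (p ^ (k + 1))) := by
    rw [ZMod.coe_int_isUnit_iff_isCoprime, Nat.cast_pow]
    exact ((Nat.prime_iff_prime_int.mp hp).irreducible.coprime_iff_not_dvd.mpr hi).pow_left
  have hpow (x) (hx : x ∈ (ZMod.unitsMap hdvd).ker) : ∃ y, y ^ 3 = x := by
    obtain ⟨X, hX⟩ := ZMod.intCast_surjective (x : ZMod (p ^ (k + 1)))
    have h1 : ((X : ℤ) : ZMod (p ^ k)) = (1 : ℤ) := by
      have := congrArg Units.val (MonoidHom.mem_ker.mp hx)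
      rw [ZMod.unitsMap_val, ← hX, ZMod.cast_intCast hdvd] at this
      simpa using this
    rw [eq_comm, ZMod.intCast_eq_intCast_iff_dvd_sub] at h1
    obtain ⟨Y, hY⟩ := exists_pow_three_sub_dvd hp hk h3 (by exact_mod_cast h1)
    have hYx : (Y : ZMod (p ^ (k + 1))) ^ 3 = x := by
      rw [← hX, eq_comm, ← Int.cast_pow, ZMod.intCast_eq_intCast_iff_dvd_sub]
      exact_mod_cast hY
    obtain ⟨y, hy⟩ := (isUnit_pow_iff three_ne_zero).mp (hYx ▸ x.isUnit)
    exact ⟨y, Units.ext (by rw [Units.val_pow_eq_pow_val, hy, hYx])⟩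
  have key := natCard_unitSolutions_mul_natCard_ker (ZMod.castHom hdvd (ZMod (p ^ k)))
    hsurj 3 hpow (fun j => (a j : ZMod (p ^ (k + 1)))) n i hunit
  rw [Ncount_eq_natCard_unitSolutions a n (Nat.one_lt_pow k.succ_ne_zero hp.one_lt),
    Ncount_eq_natCard_unitSolutions a n (Nat.one_lt_pow (Nat.ne_zero_of_lt hk) hp.one_lt)]
  change _ * Nat.card (ZMod.unitsMap hdvd).ker = Nat.card (ZMod.unitsMap hdvd).ker ^ _ * _ at key
  simp only [hcard, map_intCast, Fintype.card_fin] at key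
  refine Nat.eq_of_mul_eq_mul_right hp.pos ?_
  rw [key]
  ring

theorem singular_series_factor_stable (a : Fin 9 → ℤ) (n : ℤ) (hcop : IsCoprime (a 0) (a 1))
    {p k : ℕ} (hp : p.Prime) (hk : 1 ≤ k) (h3 : p = 3 → 2 ≤ k) {η : ℕ} (hη : k ≤ η) :
    (p : ℝ) ^ η / ((Nat.totient (p ^ η) : ℝ)) ^ 9 * (Ncount a n (p ^ η) : ℝ) =
      (p : ℝ) ^ k / ((Nat.totient (p ^ k) : ℝ)) ^ 9 * (Ncount a n (p ^ k) : ℝ) := by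
  induction η, hη using Nat.le_induction with
  | base => rfl
  | succ l hl ih =>
    have hp0 : (p : ℝ) ≠ 0 := by exact_mod_cast hp.ne_zero
    have hφ0 : (Nat.totient (p ^ l) : ℝ) ≠ 0 := by
      exact_mod_cast (Nat.totient_pos.mpr (pow_pos hp.pos l)).ne'
    rw [← ih, Ncount_prime_pow_succ a n hcop hp (hk.trans hl) fun h => (h3 h).trans hl,
      totient_prime_pow_succ_eq_mul hp (hk.trans hl)]
    push_cast
    field_simp
    ring

/-- Under the coprimality conditions: for every prime `p ≠ 3` and `η ≥ 1`,
`p^η φ(p^η)^{−9} N(p^η) = p φ(p)^{−9} N(p)`; and for every `η ≥ 3`,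
`3^η φ(3^η)^{−9} N(3^η) = 3³ φ(3³)^{−9} N(3³)`. -/
theorem Ncount_stabilizes (a : Fin 9 → ℤ) (ha : ∀ j, a j ≠ 0) (n : ℤ)
    (hcop : ∀ i j, i ≠ j → IsCoprime (a i) (a j))
    (hn : ∀ d : ℤ, d ∣ n → (∀ j, d ∣ a j) → IsUnit d) :
    (∀ p : ℕ, p.Prime → p ≠ 3 → ∀ η : ℕ, 1 ≤ η →
      (p : ℝ) ^ η / ((Nat.totient (p ^ η) : ℝ)) ^ 9 * (Ncount a n (p ^ η) : ℝ) =
        (p : ℝ) / ((Nat.totient p : ℝ)) ^ 9 * (Ncount a n p : ℝ)) ∧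
    (∀ η : ℕ, 3 ≤ η →
      (3 : ℝ) ^ η / ((Nat.totient (3 ^ η) : ℝ)) ^ 9 * (Ncount a n (3 ^ η) : ℝ) =
        (3 : ℝ) ^ 3 / ((Nat.totient (3 ^ 3) : ℝ)) ^ 9 * (Ncount a n (3 ^ 3) : ℝ)) := by
  have h01 := hcop 0 1 (by decide)
  refine ⟨fun p hp hp3 η hη => ?_, fun η hη => ?_⟩
  · simpa using singular_series_factor_stable a n h01 hp le_rfl (fun h => absurd h hp3) hη
  · exact_mod_cast singular_series_factor_stable a n h01 Nat.prime_three (by norm_num)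
      (fun _ => by norm_num) hη
end

section
/- Let a₁,…,a₉ be nonzero integers and n an integer with a₁+⋯+a₉ ≡ n (mod 2), (aᵢ,aⱼ)=1 for 1≤i<j≤9, and (n,a₁,…,a₉)=1. Then there are absolute constants c > 0 and c' > 0 such that 𝔖(n) ≥ c'·(log log D)^{−c}, where D := max{2, |a₁|, …, |a₉|}. -/
open scoped BigOperators Classical

namespace SingularSeries

/-- The sum of `e(x h³ / q)` over the units `h` modulo `q`. -/
noncomputable def unitCubeSum (q : ℕ) [NeZero q] (x : ZMod q) : ℂ :=
  ∑ h : (ZMod q)ˣ, ZMod.stdAddChar (x * (h : ZMod q) ^ 3)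

/-- The unnormalised term of the singular series, as a sum over the units modulo `q`. -/
noncomputable def unitSum (q : ℕ) [NeZero q] (a : Fin 9 → ℤ) (n : ℤ) : ℂ :=
  ∑ u : (ZMod q)ˣ,
    ZMod.stdAddChar (-((n : ZMod q) * (u : ZMod q))) *
      ∏ j, unitCubeSum q ((a j : ZMod q) * (u : ZMod q))

lemma e_div_eq_stdAddChar (q : ℕ) [NeZero q] (j : ℤ) :
    e ((j : ℝ) / (q : ℝ)) = (ZMod.stdAddChar (j : ZMod q) : ℂ) := by
  rw [ZMod.stdAddChar_coe, e]
  congr 1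
  push_cast
  ring

lemma sum_coprime_eq_sum_units (q : ℕ) [NeZero q] (F : ZMod q → ℂ) :
    ∑ k ∈ Finset.filter (fun k => Nat.gcd k q = 1) (Finset.Icc 1 q), F (k : ZMod q) =
      ∑ u : (ZMod q)ˣ, F u := by
  have hq : 0 < q := NeZero.pos q
  refine Finset.sum_bij (fun k hk => ZMod.unitOfCoprime k (Finset.mem_filter.1 hk).2)
    (fun _ _ => Finset.mem_univ _) ?_ ?_ ?_
  · intro k hk l hl h
    have h' : (k : ZMod q) = (l : ZMod q) := by
      simpa using congrArg (Units.val) h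
    rw [ZMod.natCast_eq_natCast_iff] at h'
    simp only [Finset.mem_filter, Finset.mem_Icc] at hk hl
    have h1 := (Nat.modEq_iff_dvd.1 h')
    obtain ⟨t, ht⟩ := h1
    have hkq : (k : ℤ) ≤ q := by exact_mod_cast hk.1.2
    have hlq : (l : ℤ) ≤ q := by exact_mod_cast hl.1.2
    have hk1 : (1 : ℤ) ≤ k := by exact_mod_cast hk.1.1
    have hl1 : (1 : ℤ) ≤ l := by exact_mod_cast hl.1.1
    have hq' : (0 : ℤ) < q := by exact_mod_cast hq
    have ht0 : t = 0 := by
      have h3 : t < 1 := by nlinarith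
      have h4 : -1 < t := by nlinarith
      omega
    subst ht0
    omega
  · intro u _
    have hu := ZMod.val_coe_unit_coprime u
    rcases Nat.eq_zero_or_pos (u : ZMod q).val with h0 | h0
    · refine ⟨q, ?_, ?_⟩
      · rw [h0] at hu
        have : q = 1 := by simpa using hu
        subst this
        simp
      · ext
        simpa using ((ZMod.val_eq_zero _).1 h0).symm
    · refine ⟨(u : ZMod q).val, ?_, ?_⟩
      · simp only [Finset.mem_filter, Finset.mem_Icc]
        exact ⟨⟨h0, (ZMod.val_lt _).le⟩, hu⟩
      · ext
        simp
  · intro k hk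
    simp

lemma Cq_eq_unitCubeSum (q : ℕ) [NeZero q] (x : ℤ) : Cq q x = unitCubeSum q x := by
  rw [unitCubeSum, ← sum_coprime_eq_sum_units q (fun y => ZMod.stdAddChar ((x : ZMod q) * y ^ 3)),
    Cq]
  refine Finset.sum_congr rfl fun h _ => ?_
  have := e_div_eq_stdAddChar q (x * (h : ℤ) ^ 3)
  push_cast at this
  exact this

lemma Aq_eq_unitSum (a : Fin 9 → ℤ) (n : ℤ) (q : ℕ) [NeZero q] :
    Aq a n q = unitSum q a n / (Nat.totient q : ℂ) ^ 9 := by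
  rw [unitSum, ← sum_coprime_eq_sum_units q (fun y => ZMod.stdAddChar (-((n : ZMod q) * y)) *
    ∏ j, unitCubeSum q ((a j : ZMod q) * y)), Aq, one_div_mul_eq_div]
  congr 1
  refine Finset.sum_congr rfl fun k _ => ?_
  have := e_div_eq_stdAddChar q (-(n * (k : ℤ)))
  push_cast at this
  rw [this]
  simp_rw [Cq_eq_unitCubeSum]
  push_cast
  rfl

lemma Aq_zero (a : Fin 9 → ℤ) (n : ℤ) : Aq a n 0 = 0 := by
  simp [Aq]

lemma Aq_one (a : Fin 9 → ℤ) (n : ℤ) : Aq a n 1 = 1 := by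
  have hψ (x : ZMod 1) : ZMod.stdAddChar x = 1 := by
    rw [Subsingleton.elim x 0, AddChar.map_zero_eq_one]
  rw [Aq_eq_unitSum]
  simp [unitSum, unitCubeSum, hψ]

lemma norm_stdAddChar (q : ℕ) [NeZero q] (x : ZMod q) : ‖ZMod.stdAddChar x‖ = 1 := by
  rw [ZMod.stdAddChar_apply, Circle.norm_coe]

lemma conj_stdAddChar (q : ℕ) [NeZero q] (x : ZMod q) :
    starRingEnd ℂ (ZMod.stdAddChar x) = ZMod.stdAddChar (-x) :=
  (AddChar.map_neg_eq_conj _ _).symm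

lemma conj_unitCubeSum (q : ℕ) [NeZero q] (x : ZMod q) :
    starRingEnd ℂ (unitCubeSum q x) = unitCubeSum q (-x) := by
  simp_rw [unitCubeSum, map_sum, conj_stdAddChar, neg_mul]

lemma conj_unitSum (q : ℕ) [NeZero q] (a : Fin 9 → ℤ) (n : ℤ) :
    starRingEnd ℂ (unitSum q a n) = unitSum q a n := by
  simp_rw [unitSum, map_sum, map_mul, map_prod, conj_unitCubeSum, conj_stdAddChar]
  exact Fintype.sum_equiv (Equiv.neg _) _ _ fun u => by simp

lemma conj_Aq (a : Fin 9 → ℤ) (n : ℤ) (q : ℕ) : starRingEnd ℂ (Aq a n q) = Aq a n q := by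
  rcases eq_or_ne q 0 with rfl | hq
  · simp [Aq_zero]
  · have : NeZero q := ⟨hq⟩
    rw [Aq_eq_unitSum]
    simp [conj_unitSum]

/-! ### Multiplicativity -/

lemma stdAddChar_mul_of_coprime {l m : ℕ} [NeZero l] [NeZero m] (h : l.Coprime m) :
    ∃ (c : (ZMod l)ˣ) (d : (ZMod m)ˣ), ∀ x : ZMod (l * m),
      (ZMod.stdAddChar x : ℂ) =
        ZMod.stdAddChar ((c : ZMod l) * (ZMod.chineseRemainder h x).1) *
        ZMod.stdAddChar ((d : ZMod m) * (ZMod.chineseRemainder h x).2) := by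
  obtain ⟨s, t, hst⟩ := Nat.isCoprime_iff_coprime.2 h
  have hc : (t : ZMod l) * (m : ZMod l) = 1 := by
    have := congrArg (Int.cast : ℤ → ZMod l) hst
    push_cast at this
    simpa using this
  have hd : (s : ZMod m) * (l : ZMod m) = 1 := by
    have := congrArg (Int.cast : ℤ → ZMod m) hst
    push_cast at this
    simpa using this
  refine ⟨Units.mkOfMulEqOne _ _ hc, Units.mkOfMulEqOne _ _ hd, fun x => ?_⟩
  obtain ⟨j, rfl⟩ := ZMod.intCast_surjective x
  rw [map_intCast (ZMod.chineseRemainder h)]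
  simp only [Units.val_mkOfMulEqOne, Prod.fst_intCast, Prod.snd_intCast]
  rw [← Int.cast_mul, ← Int.cast_mul, ZMod.stdAddChar_coe, ZMod.stdAddChar_coe,
    ZMod.stdAddChar_coe, ← Complex.exp_add]
  congr 1
  have hl : (l : ℂ) ≠ 0 := Nat.cast_ne_zero.2 (NeZero.ne l)
  have hm : (m : ℂ) ≠ 0 := Nat.cast_ne_zero.2 (NeZero.ne m)
  have hst' : (s : ℂ) * l + t * m = 1 := by exact_mod_cast hst
  push_cast
  field_simp
  linear_combination (-(j : ℂ)) * hst'

/-- The Chinese remainder theorem for unit groups. -/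
noncomputable def unitsChineseRemainder {l m : ℕ} (h : l.Coprime m) :
    (ZMod (l * m))ˣ ≃* (ZMod l)ˣ × (ZMod m)ˣ :=
  (Units.mapEquiv (ZMod.chineseRemainder h).toMulEquiv).trans MulEquiv.prodUnits

lemma unitsChineseRemainder_fst {l m : ℕ} (h : l.Coprime m) (u : (ZMod (l * m))ˣ) :
    ((unitsChineseRemainder h u).1 : ZMod l) = (ZMod.chineseRemainder h u).1 := rfl

lemma unitsChineseRemainder_snd {l m : ℕ} (h : l.Coprime m) (u : (ZMod (l * m))ˣ) :
    ((unitsChineseRemainder h u).2 : ZMod m) = (ZMod.chineseRemainder h u).2 := rfl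

lemma unitSum_mul_of_coprime {l m : ℕ} [NeZero l] [NeZero m] (h : l.Coprime m)
    (a : Fin 9 → ℤ) (n : ℤ) : unitSum (l * m) a n = unitSum l a n * unitSum m a n := by
  obtain ⟨c, d, hcd⟩ := stdAddChar_mul_of_coprime h
  have hG (x : ZMod (l * m)) : unitCubeSum (l * m) x =
      unitCubeSum l (c * (ZMod.chineseRemainder h x).1) *
      unitCubeSum m (d * (ZMod.chineseRemainder h x).2) := by
    simp_rw [unitCubeSum, Finset.sum_mul_sum, ← Fintype.sum_prod_type']
    refine Fintype.sum_equiv (unitsChineseRemainder h).toEquiv _ _ fun u => ?_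
    rw [hcd]
    simp [unitsChineseRemainder_fst, unitsChineseRemainder_snd, mul_assoc]
  simp_rw [unitSum, Finset.sum_mul_sum, ← Fintype.sum_prod_type']
  refine Fintype.sum_equiv ((unitsChineseRemainder h).toEquiv.trans
    ((Equiv.mulLeft c).prodCongr (Equiv.mulLeft d))) _ _ fun u => ?_
  rw [hcd]
  simp_rw [hG, Finset.prod_mul_distrib]
  simp [unitsChineseRemainder_fst, unitsChineseRemainder_snd, mul_left_comm, mul_assoc]

lemma Aq_mul_of_coprime (a : Fin 9 → ℤ) (n : ℤ) {l m : ℕ} (h : l.Coprime m) :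
    Aq a n (l * m) = Aq a n l * Aq a n m := by
  rcases eq_or_ne l 0 with rfl | hl
  · simp [Aq_zero]
  rcases eq_or_ne m 0 with rfl | hm
  · simp [Aq_zero]
  have : NeZero l := ⟨hl⟩
  have : NeZero m := ⟨hm⟩
  rw [Aq_eq_unitSum, Aq_eq_unitSum, Aq_eq_unitSum, unitSum_mul_of_coprime h,
    Nat.totient_mul h]
  push_cast
  rw [mul_pow, mul_div_mul_comm]

/-! ### Vanishing at higher prime powers -/

lemma unitCubeSum_eq_zero {q : ℕ} [NeZero q] {x : ZMod q} (hx : IsUnit x) {s : ZMod q}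
    (hs2 : 3 * s ^ 2 = 0) (hs3 : s ^ 3 = 0) (hs : 3 * s ≠ 0) : unitCubeSum q x = 0 := by
  have hshift (t : ZMod q) : unitCubeSum q x = ∑ h : (ZMod q)ˣ,
      ZMod.stdAddChar (x * (h : ZMod q) ^ 3) *
        ZMod.stdAddChar (t * (x * (h : ZMod q) ^ 3 * (3 * s))) := by
    have hu : IsUnit (1 + t * s) :=
      IsNilpotent.isUnit_one_add ⟨3, by rw [mul_pow, hs3, mul_zero]⟩
    obtain ⟨w, hw⟩ := hu
    rw [unitCubeSum]
    refine (Fintype.sum_equiv (Equiv.mulRight w) _ _ fun h => ?_).symm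
    rw [← AddChar.map_add_eq_mul]
    congr 1
    simp only [Equiv.coe_mulRight, Units.val_mul, hw]
    linear_combination (-(x * (h : ZMod q) ^ 3 * t ^ 2)) * hs2 -
      (x * (h : ZMod q) ^ 3 * t ^ 3) * hs3
  have hsum : (q : ℂ) * unitCubeSum q x = 0 := by
    have h1 : ∑ _t : ZMod q, unitCubeSum q x = (q : ℂ) * unitCubeSum q x := by
      simp [ZMod.card]
    rw [← h1, Finset.sum_congr rfl fun t _ => hshift t, Finset.sum_comm]
    refine Finset.sum_eq_zero fun h _ => ?_
    have hne : x * (h : ZMod q) ^ 3 * (3 * s) ≠ 0 := by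
      rwa [Ne, (hx.mul (h.isUnit.pow 3)).mul_right_eq_zero]
    rw [← Finset.mul_sum, AddChar.sum_mulShift _ (ZMod.isPrimitive_stdAddChar q), if_neg hne]
    simp
  exact (mul_eq_zero.1 hsum).resolve_left (Nat.cast_ne_zero.2 (NeZero.ne q))

lemma Aq_eq_zero {q : ℕ} [NeZero q] {a : Fin 9 → ℤ} {j : Fin 9} (hj : IsUnit (a j : ZMod q))
    (n : ℤ) {s : ZMod q} (hs2 : 3 * s ^ 2 = 0) (hs3 : s ^ 3 = 0) (hs : 3 * s ≠ 0) :
    Aq a n q = 0 := by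
  rw [Aq_eq_unitSum, unitSum, Finset.sum_eq_zero, zero_div]
  intro u _
  rw [Finset.prod_eq_zero (Finset.mem_univ j), mul_zero]
  exact unitCubeSum_eq_zero (hj.mul u.isUnit) hs2 hs3 hs

lemma isUnit_intCast_of_not_dvd {p : ℕ} (hp : p.Prime) {x : ℤ} (hx : ¬ (p : ℤ) ∣ x) (k : ℕ) :
    IsUnit (x : ZMod (p ^ k)) := by
  rw [ZMod.coe_int_isUnit_iff_isCoprime]
  push_cast
  exact (((Nat.prime_iff_prime_int.1 hp).coprime_iff_not_dvd).2 hx).pow_left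

lemma Aq_prime_pow_eq_zero {p : ℕ} (hp : p.Prime) (hp3 : p ≠ 3) {a : Fin 9 → ℤ} {j : Fin 9}
    (hj : ¬ (p : ℤ) ∣ a j) (n : ℤ) (k : ℕ) : Aq a n (p ^ (k + 2)) = 0 := by
  have : NeZero p := ⟨hp.ne_zero⟩
  refine Aq_eq_zero (isUnit_intCast_of_not_dvd hp hj _) n
    (s := ((p ^ (k + 1) : ℕ) : ZMod _)) ?_ ?_ ?_
  · have : ((p ^ (k + 2) * (3 * p ^ k) : ℕ) : ZMod (p ^ (k + 2))) = 0 := by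
      rw [Nat.cast_mul, ZMod.natCast_self, zero_mul]
    rw [← this]
    push_cast
    ring
  · have : ((p ^ (k + 2) * (p ^ (2 * k + 1)) : ℕ) : ZMod (p ^ (k + 2))) = 0 := by
      rw [Nat.cast_mul, ZMod.natCast_self, zero_mul]
    rw [← this]
    push_cast
    ring
  · intro h
    have h' : ((3 * p ^ (k + 1) : ℕ) : ZMod (p ^ (k + 2))) = 0 := by exact_mod_cast h
    rw [ZMod.natCast_eq_zero_iff, pow_succ' p (k + 1),
      Nat.mul_dvd_mul_iff_right (pow_pos hp.pos _)] at h'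
    exact hp3 ((Nat.prime_dvd_prime_iff_eq hp Nat.prime_three).1 h')

lemma Aq_three_pow_eq_zero {a : Fin 9 → ℤ} {j : Fin 9}
    (hj : ¬ (3 : ℤ) ∣ a j) (n : ℤ) (k : ℕ) : Aq a n (3 ^ (k + 3)) = 0 := by
  refine Aq_eq_zero (isUnit_intCast_of_not_dvd Nat.prime_three hj _) n
    (s := ((3 ^ (k + 1) : ℕ) : ZMod _)) ?_ ?_ ?_
  · have : ((3 ^ (k + 3) * 3 ^ k : ℕ) : ZMod (3 ^ (k + 3))) = 0 := by
      rw [Nat.cast_mul, ZMod.natCast_self, zero_mul]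
    rw [← this]
    push_cast
    ring
  · have : ((3 ^ (k + 3) * (3 ^ (2 * k)) : ℕ) : ZMod (3 ^ (k + 3))) = 0 := by
      rw [Nat.cast_mul, ZMod.natCast_self, zero_mul]
    rw [← this]
    push_cast
    ring
  · intro h
    have h' : ((3 ^ (k + 2) : ℕ) : ZMod (3 ^ (k + 3))) = 0 := by
      rw [← h]
      push_cast
      ring
    rw [ZMod.natCast_eq_zero_iff, Nat.pow_dvd_pow_iff_le_right (by norm_num)] at h'
    omega

/-! ### Counting solutions with additive characters -/

lemma stdAddChar_sum {ι : Type*} (q : ℕ) [NeZero q] (s : Finset ι) (g : ι → ZMod q) :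
    (ZMod.stdAddChar (∑ i ∈ s, g i) : ℂ) = ∏ i ∈ s, ZMod.stdAddChar (g i) := by
  induction s using Finset.induction_on with
  | empty => simp
  | insert i s hi ih => rw [Finset.sum_insert hi, Finset.prod_insert hi, AddChar.map_add_eq_mul, ih]

lemma sum_stdAddChar_mul_prod_eq {ι : Type*} [Fintype ι] (q : ℕ) [NeZero q] (n : ZMod q)
    (b : Fin 9 → ι → ZMod q) :
    ∑ k : ZMod q, (ZMod.stdAddChar (-(n * k)) : ℂ) * ∏ j, ∑ i, ZMod.stdAddChar (b j i * k) =
      q * (Finset.univ.filter fun f : Fin 9 → ι => ∑ j, b j (f j) = n).card := by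
  have hprod (k : ZMod q) :
      (ZMod.stdAddChar (-(n * k)) : ℂ) * ∏ j, ∑ i, ZMod.stdAddChar (b j i * k) =
        ∑ f : Fin 9 → ι, ZMod.stdAddChar (k * (∑ j, b j (f j) - n)) := by
    rw [Fintype.prod_sum, Finset.mul_sum]
    refine Finset.sum_congr rfl fun f _ => ?_
    have hk : k * (∑ j, b j (f j) - n) = -(n * k) + ∑ j, b j (f j) * k := by
      rw [← Finset.sum_mul]
      ring
    rw [hk, AddChar.map_add_eq_mul, stdAddChar_sum]
  simp_rw [hprod]
  rw [Finset.sum_comm]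
  simp_rw [AddChar.sum_mulShift _ (ZMod.isPrimitive_stdAddChar q), sub_eq_zero, ZMod.card]
  rw [← Nat.cast_sum, Finset.sum_ite, Finset.sum_const_zero, add_zero, Finset.sum_const,
    smul_eq_mul, mul_comm]
  push_cast
  rfl

lemma sum_zmod_prime_eq (p : ℕ) [Fact p.Prime] (F : ZMod p → ℂ) :
    ∑ k, F k = F 0 + ∑ u : (ZMod p)ˣ, F u := by
  rw [Fintype.sum_eq_add_sum_subtype_ne F 0]
  congr 1
  exact (Fintype.sum_equiv unitsEquivNeZero _ _ fun u => rfl).symm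

lemma one_add_Aq_prime (p : ℕ) [Fact p.Prime] (a : Fin 9 → ℤ) (n : ℤ) :
    1 + Aq a n p = p * (Finset.univ.filter fun f : Fin 9 → (ZMod p)ˣ =>
      ∑ j, (a j : ZMod p) * (f j : ZMod p) ^ 3 = n).card / ((p : ℂ) - 1) ^ 9 := by
  have hp : p.Prime := Fact.out
  have hp1 : (p : ℂ) - 1 ≠ 0 := by
    rw [sub_ne_zero]
    exact_mod_cast hp.one_lt.ne'
  rw [← sum_stdAddChar_mul_prod_eq p (n : ZMod p)
    (fun j (h : (ZMod p)ˣ) => (a j : ZMod p) * (h : ZMod p) ^ 3), sum_zmod_prime_eq,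
    Aq_eq_unitSum, Nat.totient_prime hp, Nat.cast_sub hp.one_le, Nat.cast_one]
  have h0 : (ZMod.stdAddChar (-((n : ZMod p) * 0)) : ℂ) * ∏ j : Fin 9, ∑ h : (ZMod p)ˣ,
      ZMod.stdAddChar ((a j : ZMod p) * (h : ZMod p) ^ 3 * 0) = ((p : ℂ) - 1) ^ 9 := by
    simp [ZMod.card_units_eq_totient, Nat.totient_prime hp, Nat.cast_sub hp.one_le]
  rw [h0, add_div, div_self (pow_ne_zero _ hp1), unitSum]
  simp_rw [unitCubeSum, mul_right_comm]

/-! ### Sums attained by choosing one element from each family -/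

/-- The sums `∑ j ∈ s, b j (f j)` over all choices `f`. -/
noncomputable def attainedSums {ι : Type*} [Fintype ι] {q : ℕ} (b : Fin 9 → ι → ZMod q)
    (s : Finset (Fin 9)) : Finset (ZMod q) :=
  Finset.univ.image fun f : Fin 9 → ι => ∑ j ∈ s, b j (f j)

lemma attainedSums_nonempty {ι : Type*} [Fintype ι] [Nonempty ι] {q : ℕ} (b : Fin 9 → ι → ZMod q)
    (s : Finset (Fin 9)) : (attainedSums b s).Nonempty :=
  Finset.univ_nonempty.image _

open scoped Pointwise in
lemma image_add_attainedSums_subset {ι : Type*} [Fintype ι] {q : ℕ} (b : Fin 9 → ι → ZMod q)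
    {s : Finset (Fin 9)} {i : Fin 9} (hi : i ∉ s) :
    Finset.univ.image (b i) + attainedSums b s ⊆ attainedSums b (insert i s) := by
  intro y hy
  obtain ⟨u, hu, v, hv, rfl⟩ := Finset.mem_add.1 hy
  obtain ⟨x, -, rfl⟩ := Finset.mem_image.1 hu
  obtain ⟨f, -, rfl⟩ := Finset.mem_image.1 hv
  refine Finset.mem_image.2 ⟨Function.update f i x, Finset.mem_univ _, ?_⟩
  rw [Finset.sum_insert hi, Function.update_self]
  congr 1
  refine Finset.sum_congr rfl fun j hj => ?_
  rw [Function.update_of_ne (ne_of_mem_of_not_mem hj hi)]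

lemma card_attainedSums_prime {ι : Type*} [Fintype ι] [Nonempty ι] {p : ℕ} (hp : p.Prime)
    (b : Fin 9 → ι → ZMod p) (s : Finset (Fin 9)) :
    min p (∑ j ∈ s, ((Finset.univ.image (b j)).card - 1) + 1) ≤ (attainedSums b s).card := by
  induction s using Finset.induction_on with
  | empty =>
    have := (attainedSums_nonempty b ∅).card_pos
    simp only [Finset.sum_empty]
    omega
  | insert i s hi ih =>
    have h1 := Finset.card_le_card (image_add_attainedSums_subset b hi)
    have hne : (Finset.univ.image (b i)).Nonempty := Finset.univ_nonempty.image _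
    have h2 := ZMod.cauchy_davenport hp hne (attainedSums_nonempty b s)
    have h3 := hne.card_pos
    rw [Finset.sum_insert hi]
    omega

lemma exists_sum_eq_of_card_attainedSums {ι : Type*} [Fintype ι] {q : ℕ} [NeZero q]
    (b : Fin 9 → ι → ZMod q) (h : q ≤ (attainedSums b Finset.univ).card) (n : ZMod q) :
    ∃ f : Fin 9 → ι, ∑ j, b j (f j) = n := by
  have huniv : attainedSums b Finset.univ = Finset.univ := by
    rw [← Finset.card_eq_iff_eq_univ, ZMod.card]
    refine le_antisymm ?_ h
    simpa [ZMod.card] using Finset.card_le_univ (attainedSums b Finset.univ)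
  have hn : n ∈ attainedSums b Finset.univ := huniv ▸ Finset.mem_univ n
  obtain ⟨f, -, hf⟩ := Finset.mem_image.1 hn
  exact ⟨f, hf⟩

/-! ### Local solubility -/

lemma card_cube_eq_le (p : ℕ) [Fact p.Prime] (c : ZMod p) :
    (Finset.univ.filter fun h : (ZMod p)ˣ => (h : ZMod p) ^ 3 = c).card ≤ 3 := by
  refine le_trans ?_ ((Multiset.toFinset_card_le _).trans (Polynomial.card_nthRoots 3 c))
  refine Finset.card_le_card_of_injOn (fun h => (h : ZMod p)) ?_
    (fun x _ y _ h => Units.ext h)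
  intro h hh
  simpa [Polynomial.mem_nthRoots] using hh

lemma card_mul_cube_eq_le (p : ℕ) [Fact p.Prime] {x : ZMod p} (hx : x ≠ 0) (c : ZMod p) :
    (Finset.univ.filter fun h : (ZMod p)ˣ => x * (h : ZMod p) ^ 3 = c).card ≤ 3 := by
  refine le_trans (Finset.card_le_card ?_) (card_cube_eq_le p (x⁻¹ * c))
  intro h hh
  simp only [Finset.mem_filter, Finset.mem_univ, true_and] at hh ⊢
  rw [← hh, inv_mul_cancel_left₀ hx]

lemma card_units_zmod_prime (p : ℕ) [Fact p.Prime] :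
    (Finset.univ : Finset (ZMod p)ˣ).card = p - 1 := by
  rw [Finset.card_univ, ZMod.card_units_eq_totient, Nat.totient_prime Fact.out]

lemma le_card_image_mul_cube (p : ℕ) [Fact p.Prime] {x : ZMod p} (hx : x ≠ 0) :
    p - 1 ≤ 3 * (Finset.univ.image fun h : (ZMod p)ˣ => x * (h : ZMod p) ^ 3).card := by
  rw [← card_units_zmod_prime p]
  exact Finset.card_le_mul_card_image _ _ fun c _ => card_mul_cube_eq_le p hx c

lemma exists_sum_mul_cube_eq (p : ℕ) [Fact p.Prime] (hp5 : 5 ≤ p) {a : Fin 9 → ℤ} {i : Fin 9}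
    (ha : ∀ j ≠ i, ¬ (p : ℤ) ∣ a j) (n : ℤ) :
    ∃ f : Fin 9 → (ZMod p)ˣ, ∑ j, (a j : ZMod p) * (f j : ZMod p) ^ 3 = n := by
  set b : Fin 9 → (ZMod p)ˣ → ZMod p := fun j h => (a j : ZMod p) * (h : ZMod p) ^ 3 with hb
  refine exists_sum_eq_of_card_attainedSums b (le_trans ?_
    (card_attainedSums_prime Fact.out b Finset.univ)) n
  have hsum : 8 * ((p - 1 + 2) / 3 - 1) ≤
      ∑ j, ((Finset.univ.image (b j)).card - 1) := by
    have h8 : (Finset.univ.erase i).card = 8 := by simp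
    rw [← Finset.add_sum_erase _ _ (Finset.mem_univ i), ← h8, ← smul_eq_mul]
    refine le_trans (Finset.card_nsmul_le_sum _ _ _ fun j hj => ?_) (Nat.le_add_left _ _)
    have hj' : (a j : ZMod p) ≠ 0 := by
      rw [Ne, ZMod.intCast_zmod_eq_zero_iff_dvd]
      exact ha j (Finset.ne_of_mem_erase hj)
    have := le_card_image_mul_cube p hj'
    simp only [hb]
    omega
  omega

lemma exists_sum_mul_cube_eq_two {a : Fin 9 → ℤ} {n : ℤ} (h : ∑ j, a j ≡ n [ZMOD 2]) :
    ∃ f : Fin 9 → (ZMod 2)ˣ, ∑ j, (a j : ZMod 2) * (f j : ZMod 2) ^ 3 = n := by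
  refine ⟨1, ?_⟩
  have := (ZMod.intCast_eq_intCast_iff _ _ 2).2 h
  simpa using this

open scoped Pointwise in
lemma card_add_pair_zmod_nine {d : ZMod 9} (hd : IsUnit d) {X : Finset (ZMod 9)}
    (hX : X.Nonempty) : min 9 (X.card + 1) ≤ (({d, -d} : Finset (ZMod 9)) + X).card := by
  by_contra! hlt
  obtain ⟨x, hx⟩ := hX
  have hsub (c : ZMod 9) (hc : c ∈ ({d, -d} : Finset (ZMod 9))) :
      X.image (c + ·) = {d, -d} + X := by
    refine Finset.eq_of_subset_of_card_le ?_ ?_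
    · intro y hy
      obtain ⟨z, hz, rfl⟩ := Finset.mem_image.1 hy
      exact Finset.add_mem_add hc hz
    · rw [Finset.card_image_of_injective _ (add_right_injective c)]
      omega
  have hstep (y : ZMod 9) (hy : y ∈ X) : y + 2 * d ∈ X := by
    have h1 : d + y ∈ X.image (-d + ·) := by
      rw [hsub (-d) (by simp), ← hsub d (by simp)]
      exact Finset.mem_image_of_mem _ hy
    obtain ⟨z, hz, hzy⟩ := Finset.mem_image.1 h1
    have : z = y + 2 * d := by linear_combination hzy
    exact this ▸ hz
  have hmul (m : ℕ) : x + m * (2 * d) ∈ X := by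
    induction m with
    | zero => simpa using hx
    | succ m ih =>
      have := hstep _ ih
      rw [add_assoc] at this
      convert this using 2
      push_cast
      ring
  have huniv : X = Finset.univ := by
    refine Finset.eq_univ_of_forall fun y => ?_
    obtain ⟨w, rfl⟩ := hd
    have h2 : (2 : ZMod 9) * 5 = 1 := by decide
    have := hmul ((y - x) * 5 * (w⁻¹ : (ZMod 9)ˣ)).val
    rw [ZMod.natCast_zmod_val] at this
    convert this using 1
    have h3 : ((w⁻¹ : (ZMod 9)ˣ) : ZMod 9) * w = 1 := Units.inv_mul w
    linear_combination (-(y - x)) * h2 - (y - x) * 10 * h3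
  have h9 : X.card = 9 := by
    rw [huniv, Finset.card_univ, ZMod.card]
  have hle := Finset.card_le_card (hsub d (by simp)).subset
  rw [Finset.card_image_of_injective _ (add_right_injective d)] at hle
  omega

lemma exists_sum_sign_eq_zmod_nine {a : Fin 9 → ℤ} {i : Fin 9}
    (ha : ∀ j ≠ i, ¬ (3 : ℤ) ∣ a j) (n : ℤ) :
    ∃ f : Fin 9 → Bool, ∑ j, (if f j then (a j : ZMod 9) else -(a j : ZMod 9)) = n := by
  set b : Fin 9 → Bool → ZMod 9 :=
    fun j ε => if ε then (a j : ZMod 9) else -(a j : ZMod 9) with hb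
  have hcard (s : Finset (Fin 9)) (hs : i ∉ s) : min 9 (s.card + 1) ≤ (attainedSums b s).card := by
    induction s using Finset.induction_on with
    | empty =>
      have := (attainedSums_nonempty b ∅).card_pos
      simp only [Finset.card_empty]
      omega
    | insert k s hk ih =>
      have hki : k ≠ i := fun h => hs (h ▸ Finset.mem_insert_self _ _)
      have ih' := ih fun h => hs (Finset.mem_insert_of_mem h)
      have h1 := Finset.card_le_card (image_add_attainedSums_subset b hk)
      have himg : Finset.univ.image (b k) = {(a k : ZMod 9), -(a k : ZMod 9)} := by
        ext y
        simp [hb]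
      have h2 := card_add_pair_zmod_nine
        (isUnit_intCast_of_not_dvd Nat.prime_three (ha k hki) 2) (attainedSums_nonempty b s)
      rw [himg] at h1
      rw [Finset.card_insert_of_notMem hk]
      have h3 := h2.trans h1
      omega
  have hlast := Finset.card_le_card (image_add_attainedSums_subset b
    (Finset.notMem_erase i Finset.univ))
  rw [Finset.insert_erase (Finset.mem_univ i)] at hlast
  have herase := hcard _ (Finset.notMem_erase i Finset.univ)
  rw [Finset.card_erase_of_mem (Finset.mem_univ i), Finset.card_univ, Fintype.card_fin] at herase
  refine exists_sum_eq_of_card_attainedSums b (le_trans ?_ hlast) n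
  refine le_trans ?_ (Finset.card_le_card_add_left (Finset.univ_nonempty.image (b i)))
  simpa using herase

/-! ### The local factor at three -/

lemma sum_units_zmod_nine (F : ZMod 9 → ℂ) :
    ∑ u : (ZMod 9)ˣ, F u = F 1 + F 2 + F 4 + F 5 + F 7 + F 8 := by
  rw [← sum_coprime_eq_sum_units 9 F]
  have : Finset.filter (fun k => Nat.gcd k 9 = 1) (Finset.Icc 1 9) = {1, 2, 4, 5, 7, 8} := by
    decide
  rw [this]
  simp [add_assoc]

lemma sum_units_zmod_three (F : ZMod 3 → ℂ) : ∑ u : (ZMod 3)ˣ, F u = F 1 + F 2 := by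
  rw [← sum_coprime_eq_sum_units 3 F]
  have : Finset.filter (fun k => Nat.gcd k 3 = 1) (Finset.Icc 1 3) = {1, 2} := by
    decide
  rw [this]
  simp

lemma stdAddChar_three_eq_nine (x : ℤ) :
    (ZMod.stdAddChar (x : ZMod 3) : ℂ) = ZMod.stdAddChar ((3 * x : ℤ) : ZMod 9) := by
  rw [ZMod.stdAddChar_coe, ZMod.stdAddChar_coe]
  congr 1
  push_cast
  ring

lemma unitCubeSum_nine (x : ZMod 9) :
    unitCubeSum 9 x = 3 * (ZMod.stdAddChar x + ZMod.stdAddChar (-x)) := by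
  rw [unitCubeSum, sum_units_zmod_nine fun y => ZMod.stdAddChar (x * y ^ 3)]
  have h2 : (2 : ZMod 9) ^ 3 = -1 := by decide
  have h4 : (4 : ZMod 9) ^ 3 = 1 := by decide
  have h5 : (5 : ZMod 9) ^ 3 = -1 := by decide
  have h7 : (7 : ZMod 9) ^ 3 = 1 := by decide
  have h8 : (8 : ZMod 9) ^ 3 = -1 := by decide
  simp only [h2, h4, h5, h7, h8, one_pow, mul_one, mul_neg]
  ring

lemma unitCubeSum_three (x : ℤ) : unitCubeSum 3 (x : ZMod 3) =
    ZMod.stdAddChar ((3 * x : ℤ) : ZMod 9) + ZMod.stdAddChar (-((3 * x : ℤ) : ZMod 9)) := by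
  rw [unitCubeSum, sum_units_zmod_three fun y => ZMod.stdAddChar ((x : ZMod 3) * y ^ 3)]
  have h2 : (2 : ZMod 3) ^ 3 = -1 := by decide
  rw [h2, one_pow, mul_one, mul_neg_one, stdAddChar_three_eq_nine, ← Int.cast_neg,
    stdAddChar_three_eq_nine, mul_neg, Int.cast_neg]

lemma one_add_Aq_three (a : Fin 9 → ℤ) (n : ℤ) :
    1 + Aq a n 3 + Aq a n 9 = 9 * (Finset.univ.filter fun f : Fin 9 → Bool =>
      ∑ j, (if f j then (a j : ZMod 9) else -(a j : ZMod 9)) = n).card / 2 ^ 9 := by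
  set H : ZMod 9 → ℂ := fun k => ZMod.stdAddChar (-((n : ZMod 9) * k)) *
    ∏ j, (ZMod.stdAddChar ((a j : ZMod 9) * k) + ZMod.stdAddChar (-((a j : ZMod 9) * k))) with hH
  have hcount := sum_stdAddChar_mul_prod_eq 9 (n : ZMod 9)
    (fun j (ε : Bool) => if ε then (a j : ZMod 9) else -(a j : ZMod 9))
  have hsum : ∑ k : ZMod 9, H k = 9 * (Finset.univ.filter fun f : Fin 9 → Bool =>
      ∑ j, (if f j then (a j : ZMod 9) else -(a j : ZMod 9)) = n).card := by
    refine Eq.trans ?_ (hcount.trans (by norm_num))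
    simp [hH]
  have hexpand : ∑ k : ZMod 9, H k =
      H 0 + H 1 + H 2 + H 3 + H 4 + H 5 + H 6 + H 7 + H 8 := by
    refine (Fin.sum_univ_castSucc (n := 8) H).trans ?_
    rw [Fin.sum_univ_eight]
    rfl
  have h0 : H 0 = 2 ^ 9 := by
    simp [hH]
    norm_num
  have h9 : Aq a n 9 = (H 1 + H 2 + H 4 + H 5 + H 7 + H 8) / 2 ^ 9 := by
    have hφ : Nat.totient 9 = 6 := by decide
    rw [Aq_eq_unitSum, ← sum_units_zmod_nine H, hφ, unitSum]
    simp_rw [unitCubeSum_nine, Finset.prod_mul_distrib, hH, mul_left_comm _ (∏ _j : Fin 9, (3 : ℂ)),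
      ← Finset.mul_sum]
    simp only [Finset.prod_const, Finset.card_univ, Fintype.card_fin]
    push_cast
    ring
  have h3 : Aq a n 3 = (H 3 + H 6) / 2 ^ 9 := by
    have hφ : Nat.totient 3 = 2 := by decide
    rw [Aq_eq_unitSum, hφ, unitSum, sum_units_zmod_three fun y =>
      ZMod.stdAddChar (-((n : ZMod 3) * y)) * ∏ j, unitCubeSum 3 ((a j : ZMod 3) * y)]
    have hk (k : ℤ) : (ZMod.stdAddChar (-((n : ZMod 3) * (k : ZMod 3))) : ℂ) *
        ∏ j, unitCubeSum 3 ((a j : ZMod 3) * (k : ZMod 3)) = H (3 * k) := by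
      simp_rw [← Int.cast_mul, unitCubeSum_three]
      rw [← Int.cast_neg, stdAddChar_three_eq_nine]
      simp only [hH]
      push_cast
      simp only [mul_neg, mul_left_comm]
    have h1 := hk 1
    have h2 := hk 2
    have h6 : (3 : ZMod 9) * 2 = 6 := by decide
    simp only [Int.cast_one, Int.cast_ofNat, mul_one, h6] at h1 h2
    simp only [mul_one] at h1 ⊢
    rw [h1, h2]
    norm_num
  rw [← hsum, hexpand, h9, h3, ← h0]
  have : H 0 ≠ 0 := by
    rw [h0]
    norm_num
  field_simp
  ring

/-! ### Bounds for the terms -/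

lemma norm_unitCubeSum_le (q : ℕ) [NeZero q] (x : ZMod q) :
    ‖unitCubeSum q x‖ ≤ Nat.totient q := by
  refine (norm_sum_le _ _).trans ?_
  simp [ZMod.card_units_eq_totient]

lemma norm_Aq_le (a : Fin 9 → ℤ) (n : ℤ) (q : ℕ) : ‖Aq a n q‖ ≤ q := by
  rcases eq_or_ne q 0 with rfl | hq
  · simp [Aq_zero]
  have : NeZero q := ⟨hq⟩
  have hφ : (0 : ℝ) < Nat.totient q := by exact_mod_cast Nat.totient_pos.2 (NeZero.pos q)
  rw [Aq_eq_unitSum, norm_div, norm_pow, Complex.norm_natCast, div_le_iff₀ (by positivity)]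
  have hle : ‖unitSum q a n‖ ≤ Nat.totient q * (Nat.totient q : ℝ) ^ 9 := by
    refine (norm_sum_le _ _).trans ?_
    rw [← ZMod.card_units_eq_totient q, ← Finset.card_univ, ← nsmul_eq_mul]
    refine Finset.sum_le_card_nsmul _ _ _ fun u _ => ?_
    rw [norm_mul, norm_stdAddChar, one_mul, norm_prod, Finset.card_univ,
      ZMod.card_units_eq_totient]
    refine (Finset.prod_le_prod (fun _ _ => norm_nonneg _)
      fun j _ => norm_unitCubeSum_le q _).trans_eq ?_
    simp
  refine hle.trans ?_
  gcongr
  exact Nat.totient_le q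

lemma sum_norm_sq_unitCubeSum_le (p : ℕ) [Fact p.Prime] :
    ∑ y : ZMod p, ‖unitCubeSum p y‖ ^ 2 ≤ 3 * p * ((p : ℝ) - 1) := by
  have hp : p.Prime := Fact.out
  have hcount : ((∑ y : ZMod p, ‖unitCubeSum p y‖ ^ 2 : ℝ) : ℂ) = ((p * ∑ h : (ZMod p)ˣ,
      (Finset.univ.filter fun g : (ZMod p)ˣ => (g : ZMod p) ^ 3 = (h : ZMod p) ^ 3).card : ℕ) :
        ℂ) := by
    push_cast
    have hsq (y : ZMod p) : ((‖unitCubeSum p y‖ : ℂ)) ^ 2 = ∑ h : (ZMod p)ˣ, ∑ g : (ZMod p)ˣ,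
        ZMod.stdAddChar (y * ((h : ZMod p) ^ 3 - (g : ZMod p) ^ 3)) := by
      rw [← Complex.mul_conj', conj_unitCubeSum, unitCubeSum, unitCubeSum, Finset.sum_mul_sum]
      refine Finset.sum_congr rfl fun h _ => Finset.sum_congr rfl fun g _ => ?_
      rw [← AddChar.map_add_eq_mul]
      congr 1
      ring
    simp_rw [hsq]
    rw [Finset.sum_comm, Finset.mul_sum]
    refine Finset.sum_congr rfl fun h _ => ?_
    rw [Finset.sum_comm]
    simp_rw [AddChar.sum_mulShift _ (ZMod.isPrimitive_stdAddChar p), sub_eq_zero, ZMod.card]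
    rw [← Nat.cast_sum, Finset.sum_ite, Finset.sum_const_zero, add_zero, Finset.sum_const,
      smul_eq_mul, mul_comm]
    push_cast
    simp_rw [eq_comm (a := (h : ZMod p) ^ 3)]
  have hcount' : ∑ y : ZMod p, ‖unitCubeSum p y‖ ^ 2 = ((p * ∑ h : (ZMod p)ˣ,
      (Finset.univ.filter fun g : (ZMod p)ˣ => (g : ZMod p) ^ 3 = (h : ZMod p) ^ 3).card : ℕ) :
        ℝ) := by
    exact_mod_cast hcount
  have hle : ∑ h : (ZMod p)ˣ, (Finset.univ.filter fun g : (ZMod p)ˣ =>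
      (g : ZMod p) ^ 3 = (h : ZMod p) ^ 3).card ≤ (p - 1) * 3 := by
    rw [← card_units_zmod_prime p, ← smul_eq_mul]
    exact Finset.sum_le_card_nsmul _ _ _ fun h _ => card_cube_eq_le p _
  rw [hcount']
  have hle' : ((p * ∑ h : (ZMod p)ˣ, (Finset.univ.filter fun g : (ZMod p)ˣ =>
      (g : ZMod p) ^ 3 = (h : ZMod p) ^ 3).card : ℕ) : ℝ) ≤ ((p * ((p - 1) * 3) : ℕ) : ℝ) := by
    exact_mod_cast Nat.mul_le_mul_left p hle
  refine hle'.trans_eq ?_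
  rw [Nat.cast_mul, Nat.cast_mul, Nat.cast_sub hp.one_le]
  push_cast
  ring

lemma unitCubeSum_mul_cube (q : ℕ) [NeZero q] (x : ZMod q) (u : (ZMod q)ˣ) :
    unitCubeSum q (x * (u : ZMod q) ^ 3) = unitCubeSum q x := by
  refine Fintype.sum_equiv (Equiv.mulLeft u) _ _ fun h => ?_
  simp [mul_pow, mul_assoc]

lemma norm_unitCubeSum_prime_le (p : ℕ) [Fact p.Prime] {x : ZMod p} (hx : x ≠ 0) :
    ‖unitCubeSum p x‖ ≤ 3 * √p := by
  have hp : p.Prime := Fact.out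
  have hp1 : (0 : ℝ) < (p : ℝ) - 1 := by
    rw [sub_pos]
    exact_mod_cast hp.one_lt
  have hsum : ((p : ℝ) - 1) * ‖unitCubeSum p x‖ ^ 2 ≤ 3 * ∑ y : ZMod p, ‖unitCubeSum p y‖ ^ 2 := by
    have h1 : ((p : ℝ) - 1) * ‖unitCubeSum p x‖ ^ 2 =
        ∑ u : (ZMod p)ˣ, ‖unitCubeSum p (x * (u : ZMod p) ^ 3)‖ ^ 2 := by
      simp_rw [unitCubeSum_mul_cube]
      rw [Finset.sum_const, card_units_zmod_prime, nsmul_eq_mul, Nat.cast_sub hp.one_le,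
        Nat.cast_one]
    rw [h1, ← Finset.sum_fiberwise' Finset.univ (fun u : (ZMod p)ˣ => x * (u : ZMod p) ^ 3)
      (fun y => ‖unitCubeSum p y‖ ^ 2), Finset.mul_sum]
    refine Finset.sum_le_sum fun y _ => ?_
    rw [Finset.sum_const, nsmul_eq_mul]
    gcongr
    exact_mod_cast card_mul_cube_eq_le p hx y
  have hsq : ‖unitCubeSum p x‖ ^ 2 ≤ 9 * p := by
    have h2 := sum_norm_sq_unitCubeSum_le p
    refine le_of_mul_le_mul_left (a := (p : ℝ) - 1) ?_ hp1
    linarith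
  refine le_of_sq_le_sq ?_ (by positivity)
  rw [mul_pow, Real.sq_sqrt (Nat.cast_nonneg p)]
  linarith

lemma norm_Aq_prime_le (p : ℕ) [Fact p.Prime] {a : Fin 9 → ℤ} {i : Fin 9}
    (ha : ∀ j ≠ i, ¬ (p : ℤ) ∣ a j) (n : ℤ) : ‖Aq a n p‖ ≤ 839808 / (p : ℝ) ^ 2 := by
  have hp : p.Prime := Fact.out
  have hp2 : (2 : ℝ) ≤ p := by exact_mod_cast hp.two_le
  have hp1 : (0 : ℝ) < (p : ℝ) - 1 := by linarith
  have htot : ((Nat.totient p : ℕ) : ℝ) = (p : ℝ) - 1 := by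
    rw [Nat.totient_prime hp, Nat.cast_sub hp.one_le, Nat.cast_one]
  have hle : ‖unitSum p a n‖ ≤ ((p : ℝ) - 1) * (((p : ℝ) - 1) * (3 * √p) ^ 8) := by
    refine (norm_sum_le _ _).trans ?_
    nth_rewrite 1 [← htot]
    rw [← ZMod.card_units_eq_totient p, ← Finset.card_univ, ← nsmul_eq_mul]
    refine Finset.sum_le_card_nsmul _ _ _ fun u _ => ?_
    rw [norm_mul, norm_stdAddChar, one_mul, norm_prod,
      ← Finset.mul_prod_erase _ _ (Finset.mem_univ i), ← htot]
    refine mul_le_mul (norm_unitCubeSum_le p _) ?_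
      (Finset.prod_nonneg fun _ _ => norm_nonneg _) (Nat.cast_nonneg _)
    refine (Finset.prod_le_prod (fun _ _ => norm_nonneg _) (fun j hj =>
      norm_unitCubeSum_prime_le p (x := (a j : ZMod p) * (u : ZMod p)) ?_)).trans_eq ?_
    · refine mul_ne_zero ?_ u.ne_zero
      rw [Ne, ZMod.intCast_zmod_eq_zero_iff_dvd]
      exact ha j (Finset.ne_of_mem_erase hj)
    · simp
  have hsqrt : (3 * √(p : ℝ)) ^ 8 = 6561 * (p : ℝ) ^ 4 := by
    have : (3 * √(p : ℝ)) ^ 8 = 6561 * (√(p : ℝ) ^ 2) ^ 4 := by ring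
    rw [this, Real.sq_sqrt (Nat.cast_nonneg p)]
  rw [Aq_eq_unitSum, norm_div, norm_pow, Complex.norm_natCast, htot,
    div_le_div_iff₀ (by positivity) (by positivity)]
  have h7 : (p : ℝ) ^ 7 ≤ 128 * ((p : ℝ) - 1) ^ 7 := by
    have : (p : ℝ) ^ 7 ≤ (2 * ((p : ℝ) - 1)) ^ 7 := by
      gcongr
      linarith
    calc (p : ℝ) ^ 7 ≤ (2 * ((p : ℝ) - 1)) ^ 7 := this
      _ = 128 * ((p : ℝ) - 1) ^ 7 := by ring
  have h6 : (p : ℝ) ^ 6 ≤ (p : ℝ) ^ 7 := pow_le_pow_right₀ (by linarith) (by norm_num)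
  calc ‖unitSum p a n‖ * (p : ℝ) ^ 2
      ≤ ((p : ℝ) - 1) * (((p : ℝ) - 1) * (3 * √p) ^ 8) * (p : ℝ) ^ 2 := by gcongr
    _ = 6561 * ((p : ℝ) - 1) ^ 2 * (p : ℝ) ^ 6 := by rw [hsqrt]; ring
    _ ≤ 6561 * ((p : ℝ) - 1) ^ 2 * (128 * ((p : ℝ) - 1) ^ 7) := by
        gcongr
        exact h6.trans h7
    _ = 839808 * ((p : ℝ) - 1) ^ 9 := by ring

/-! ### Assembling the Euler product -/

lemma summable_norm_of_multiplicative {f : ℕ → ℝ} (h0 : f 0 = 0) (h1 : f 1 = 1)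
    (hmul : ∀ {m n : ℕ}, m.Coprime n → f (m * n) = f m * f n)
    (hsum : ∀ {p : ℕ}, p.Prime → Summable fun k : ℕ => ‖f (p ^ k)‖) {b : ℕ → ℝ}
    (hb : Summable b) (hb0 : ∀ n, 0 ≤ b n)
    (hle : ∀ {p : ℕ}, p.Prime → ∑' k : ℕ, ‖f (p ^ k)‖ ≤ 1 + b p) :
    Summable fun n => ‖f n‖ := by
  refine summable_of_sum_range_le (c := Real.exp (∑' n, b n)) (fun n => norm_nonneg _) fun N => ?_
  have hsmooth := (EulerProduct.summable_and_hasSum_smoothNumbers_prod_primesBelow_tsum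
    (f := fun n => ‖f n‖) (by simp [h1]) (fun h => by rw [hmul h, norm_mul])
    (fun hp => by simpa using hsum hp) N).2
  have hind := (hasSum_subtype_iff_indicator (f := fun n => ‖f n‖)).1 hsmooth
  have hnonneg (n : ℕ) : 0 ≤ (N.smoothNumbers).indicator (fun n => ‖f n‖) n :=
    Set.indicator_nonneg (fun _ _ => norm_nonneg _) _
  calc ∑ n ∈ Finset.range N, ‖f n‖
      = ∑ n ∈ Finset.range N, (N.smoothNumbers).indicator (fun n => ‖f n‖) n := by
        refine Finset.sum_congr rfl fun n hn => ?_
        rcases Nat.eq_zero_or_pos n with rfl | hpos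
        · simp [h0, Set.indicator_apply]
        · rw [Set.indicator_of_mem (Nat.mem_smoothNumbers_of_lt hpos (Finset.mem_range.1 hn))]
    _ ≤ ∏ p ∈ N.primesBelow, ∑' k : ℕ, ‖f (p ^ k)‖ :=
        sum_le_hasSum _ (fun n _ => hnonneg n) hind
    _ ≤ ∏ p ∈ N.primesBelow, Real.exp (b p) := by
        refine Finset.prod_le_prod (fun p _ => tsum_nonneg fun k => norm_nonneg _) fun p hp => ?_
        refine (hle (Nat.prime_of_mem_primesBelow hp)).trans ?_
        rw [add_comm]
        exact Real.add_one_le_exp _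
    _ = Real.exp (∑ p ∈ N.primesBelow, b p) := (Real.exp_sum _ _).symm
    _ ≤ Real.exp (∑' n, b n) :=
        Real.exp_le_exp.2 (hb.sum_le_tsum _ fun n _ => hb0 n)

lemma exists_pos_le_prod {g : ℕ → ℝ} (hpos : ∀ n, 0 < g n) (hle : ∀ n, g n ≤ 1)
    (hg : Summable fun n => g n - 1) : ∃ c : ℝ, 0 < c ∧ ∀ s : Finset ℕ, c ≤ ∏ n ∈ s, g n := by
  have hlog : Summable fun n => -Real.log (g n) := by
    have := (Real.summable_log_one_add_of_summable hg).neg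
    simpa using this
  refine ⟨Real.exp (-∑' n, -Real.log (g n)), Real.exp_pos _, fun s => ?_⟩
  have hprod : ∏ n ∈ s, g n = Real.exp (-∑ n ∈ s, -Real.log (g n)) := by
    rw [Finset.sum_neg_distrib, neg_neg, Real.exp_sum]
    exact Finset.prod_congr rfl fun n _ => (Real.exp_log (hpos n)).symm
  rw [hprod, Real.exp_le_exp, neg_le_neg_iff]
  exact hlog.sum_le_tsum _ fun n _ => neg_nonneg.2 (Real.log_nonpos (hpos n).le (hle n))

/-- A lower bound for the local factor of the singular series at a prime `p`. -/
noncomputable def localBound (p : ℕ) : ℝ :=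
  if p = 0 then 1 else max (((p : ℝ) ^ 8)⁻¹) (1 - 839808 / (p : ℝ) ^ 2)

lemma summable_const_div_sq : Summable fun n : ℕ => (839808 : ℝ) / (n : ℝ) ^ 2 := by
  simpa [div_eq_mul_inv] using
    (Real.summable_nat_pow_inv.2 (by norm_num : 1 < 2)).mul_left (839808 : ℝ)

lemma localBound_pos (p : ℕ) : 0 < localBound p := by
  rw [localBound]
  split_ifs with h
  · exact one_pos
  · exact lt_max_of_lt_left (by positivity)

lemma localBound_le_one (p : ℕ) : localBound p ≤ 1 := by
  rw [localBound]
  split_ifs with h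
  · exact le_rfl
  · have hp : (1 : ℝ) ≤ p := by exact_mod_cast Nat.one_le_iff_ne_zero.2 h
    refine max_le (inv_le_one_of_one_le₀ (one_le_pow₀ hp)) ?_
    rw [sub_le_self_iff]
    positivity

lemma summable_localBound_sub_one : Summable fun n => localBound n - 1 := by
  refine Summable.of_norm_bounded summable_const_div_sq fun n => ?_
  rw [Real.norm_eq_abs, abs_sub_comm, abs_of_nonneg (sub_nonneg.2 (localBound_le_one n)),
    localBound]
  split_ifs with h
  · rw [sub_self]
    positivity
  · linarith [le_max_right (((n : ℝ) ^ 8)⁻¹) (1 - 839808 / (n : ℝ) ^ 2)]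

lemma exists_forall_ne_not_dvd {a : Fin 9 → ℤ} (ha : ∀ i j, i ≠ j → IsCoprime (a i) (a j))
    {p : ℕ} (hp : p.Prime) : ∃ i, ∀ j ≠ i, ¬ (p : ℤ) ∣ a j := by
  by_cases h : ∃ i, (p : ℤ) ∣ a i
  · obtain ⟨i, hi⟩ := h
    refine ⟨i, fun j hj hdvd => ?_⟩
    exact (Nat.prime_iff_prime_int.1 hp).not_isUnit ((ha j i hj).isUnit_of_dvd' hdvd hi)
  · push Not at h
    exact ⟨0, fun j _ => h j⟩

lemma inv_pow_eight_le {p : ℕ} (hp : p.Prime) {N : ℕ} (hN : 1 ≤ N) :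
    ((p : ℝ) ^ 8)⁻¹ ≤ p * N / ((p : ℝ) - 1) ^ 9 := by
  have hp1 : (1 : ℝ) < p := by exact_mod_cast hp.one_lt
  have hN' : (1 : ℝ) ≤ N := by exact_mod_cast hN
  have h1 : (0 : ℝ) < (p : ℝ) - 1 := sub_pos.2 hp1
  rw [← one_div, div_le_div_iff₀ (by positivity) (by positivity), one_mul]
  calc ((p : ℝ) - 1) ^ 9 ≤ (p : ℝ) ^ 9 := by
        gcongr
        linarith
    _ = p * 1 * (p : ℝ) ^ 8 := by ring
    _ ≤ p * N * (p : ℝ) ^ 8 := by gcongr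

section LocalFactors

variable {a : Fin 9 → ℤ} {n : ℤ}

lemma ofReal_re_Aq (a : Fin 9 → ℤ) (n : ℤ) (q : ℕ) : (((Aq a n q).re : ℝ) : ℂ) = Aq a n q :=
  Complex.conj_eq_iff_re.1 (conj_Aq a n q)

lemma Aq_prime_pow_eq_zero_of_three_le (ha : ∀ i j, i ≠ j → IsCoprime (a i) (a j)) {p : ℕ}
    (hp : p.Prime) {k : ℕ} (hk : 3 ≤ k) : Aq a n (p ^ k) = 0 := by
  obtain ⟨i, hi⟩ := exists_forall_ne_not_dvd ha hp
  obtain ⟨j, hj⟩ := exists_ne i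
  rcases eq_or_ne p 3 with rfl | hp3
  · obtain ⟨l, rfl⟩ := Nat.exists_eq_add_of_le' hk
    exact Aq_three_pow_eq_zero (hi j hj) n l
  · obtain ⟨l, rfl⟩ := Nat.exists_eq_add_of_le' (Nat.le_of_succ_le hk)
    exact Aq_prime_pow_eq_zero hp hp3 (hi j hj) n l

lemma hasSum_norm_Aq_prime_pow (ha : ∀ i j, i ≠ j → IsCoprime (a i) (a j)) {p : ℕ}
    (hp : p.Prime) : HasSum (fun k : ℕ => ‖(Aq a n (p ^ k)).re‖)
      (1 + ‖(Aq a n p).re‖ + ‖(Aq a n (p ^ 2)).re‖) := by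
  have := hasSum_sum_of_ne_finset_zero (L := .unconditional ℕ)
    (f := fun k : ℕ => ‖(Aq a n (p ^ k)).re‖) (s := Finset.range 3) fun k hk => by
      rw [Aq_prime_pow_eq_zero_of_three_le ha hp (by simpa using hk)]
      simp
  simpa [Finset.sum_range_succ, Aq_one] using this

lemma hasSum_Aq_prime_pow (ha : ∀ i j, i ≠ j → IsCoprime (a i) (a j)) {p : ℕ}
    (hp : p.Prime) : HasSum (fun k : ℕ => (Aq a n (p ^ k)).re)
      (1 + (Aq a n p).re + (Aq a n (p ^ 2)).re) := by
  have := hasSum_sum_of_ne_finset_zero (L := .unconditional ℕ)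
    (f := fun k : ℕ => (Aq a n (p ^ k)).re) (s := Finset.range 3) fun k hk => by
      rw [Aq_prime_pow_eq_zero_of_three_le ha hp (by simpa using hk)]
      simp
  simpa [Finset.sum_range_succ, Aq_one] using this

lemma Aq_prime_sq_eq_zero (ha : ∀ i j, i ≠ j → IsCoprime (a i) (a j)) {p : ℕ}
    (hp : p.Prime) (hp3 : p ≠ 3) : Aq a n (p ^ 2) = 0 := by
  obtain ⟨i, hi⟩ := exists_forall_ne_not_dvd ha hp
  obtain ⟨j, hj⟩ := exists_ne i
  exact Aq_prime_pow_eq_zero hp hp3 (hi j hj) n 0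

lemma tsum_norm_Aq_prime_pow_le (ha : ∀ i j, i ≠ j → IsCoprime (a i) (a j)) {p : ℕ}
    (hp : p.Prime) : ∑' k : ℕ, ‖(Aq a n (p ^ k)).re‖ ≤ 1 + 839808 / (p : ℝ) ^ 2 := by
  rw [(hasSum_norm_Aq_prime_pow ha hp).tsum_eq, add_assoc]
  gcongr
  have hre (q : ℕ) : ‖(Aq a n q).re‖ ≤ ‖Aq a n q‖ := Complex.abs_re_le_norm _
  rcases eq_or_ne p 3 with rfl | hp3
  · have h3 := (hre 3).trans (norm_Aq_le a n 3)
    have h9 := (hre (3 ^ 2)).trans (norm_Aq_le a n (3 ^ 2))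
    norm_num at h3 h9 ⊢
    linarith
  · rw [Aq_prime_sq_eq_zero ha hp hp3]
    have : Fact p.Prime := ⟨hp⟩
    obtain ⟨i, hi⟩ := exists_forall_ne_not_dvd ha hp
    simpa using (hre p).trans (norm_Aq_prime_le p hi n)

lemma localBound_le_tsum (ha : ∀ i j, i ≠ j → IsCoprime (a i) (a j))
    (han : ∑ j, a j ≡ n [ZMOD 2]) {p : ℕ} (hp : p.Prime) :
    localBound p ≤ ∑' k : ℕ, (Aq a n (p ^ k)).re := by
  rw [(hasSum_Aq_prime_pow ha hp).tsum_eq, localBound, if_neg hp.ne_zero]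
  have : Fact p.Prime := ⟨hp⟩
  obtain ⟨i, hi⟩ := exists_forall_ne_not_dvd ha hp
  rcases eq_or_ne p 3 with rfl | hp3
  · obtain ⟨f, hf⟩ := exists_sum_sign_eq_zmod_nine (by exact_mod_cast hi) n
    have hcount : 1 ≤ (Finset.univ.filter fun f : Fin 9 → Bool =>
        ∑ j, (if f j then (a j : ZMod 9) else -(a j : ZMod 9)) = n).card :=
      Finset.card_pos.2 ⟨f, Finset.mem_filter.2 ⟨Finset.mem_univ _, hf⟩⟩
    set N := (Finset.univ.filter fun f : Fin 9 → Bool =>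
        ∑ j, (if f j then (a j : ZMod 9) else -(a j : ZMod 9)) = n).card with hN
    have heq : 1 + (Aq a n 3).re + (Aq a n (3 ^ 2)).re = 9 * N / 2 ^ 9 := by
      have := one_add_Aq_three a n
      rw [← ofReal_re_Aq a n 3, ← ofReal_re_Aq a n 9, ← hN] at this
      have h9 : (3 : ℕ) ^ 2 = 9 := by norm_num
      rw [h9]
      refine Complex.ofReal_injective ?_
      push_cast
      exact this
    have hN' : (1 : ℝ) ≤ N := by exact_mod_cast hcount
    rw [heq]
    refine max_le ?_ ?_ <;> norm_num <;> linarith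
  · rw [Aq_prime_sq_eq_zero ha hp hp3, Complex.zero_re, add_zero]
    refine max_le ?_ ?_
    · have hsol : ∃ f : Fin 9 → (ZMod p)ˣ,
          ∑ j, (a j : ZMod p) * (f j : ZMod p) ^ 3 = n := by
        rcases eq_or_ne p 2 with rfl | hp2
        · exact exists_sum_mul_cube_eq_two han
        · exact exists_sum_mul_cube_eq p (hp.five_le_of_ne_two_of_ne_three hp2 hp3) hi n
      obtain ⟨f, hf⟩ := hsol
      have hcount : 1 ≤ (Finset.univ.filter fun f : Fin 9 → (ZMod p)ˣ =>
          ∑ j, (a j : ZMod p) * (f j : ZMod p) ^ 3 = n).card :=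
        Finset.card_pos.2 ⟨f, Finset.mem_filter.2 ⟨Finset.mem_univ _, hf⟩⟩
      refine (inv_pow_eight_le hp hcount).trans_eq ?_
      have := one_add_Aq_prime p a n
      rw [← ofReal_re_Aq a n p] at this
      exact_mod_cast this.symm
    · have h1 := (Complex.abs_re_le_norm _).trans (norm_Aq_prime_le p hi n)
      linarith [neg_abs_le (Aq a n p).re]

end LocalFactors

lemma exists_pos_le_singularSeries : ∃ c : ℝ, 0 < c ∧ ∀ (a : Fin 9 → ℤ) (n : ℤ),
    ∑ j, a j ≡ n [ZMOD 2] → (∀ i j, i ≠ j → IsCoprime (a i) (a j)) →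
    ∃ S : ℝ, (∑' q : ℕ, Aq a n q) = (S : ℂ) ∧ c ≤ S := by
  obtain ⟨c, hc, hprod⟩ := exists_pos_le_prod localBound_pos localBound_le_one
    summable_localBound_sub_one
  refine ⟨c, hc, fun a n han ha => ⟨∑' q : ℕ, (Aq a n q).re, ?_, ?_⟩⟩
  · rw [Complex.ofReal_tsum]
    simp_rw [ofReal_re_Aq]
  have h0 : (Aq a n 0).re = 0 := by simp [Aq_zero]
  have h1 : (Aq a n 1).re = 1 := by simp [Aq_one]
  have hmul {l m : ℕ} (h : l.Coprime m) :
      (Aq a n (l * m)).re = (Aq a n l).re * (Aq a n m).re := by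
    have := Aq_mul_of_coprime a n h
    rw [← ofReal_re_Aq a n l, ← ofReal_re_Aq a n m, ← ofReal_re_Aq a n (l * m)] at this
    exact_mod_cast this
  have hsum := summable_norm_of_multiplicative (f := fun q => (Aq a n q).re) h0 h1 hmul
    (fun hp => (hasSum_norm_Aq_prime_pow ha hp).summable) summable_const_div_sq
    (fun m => by positivity) (tsum_norm_Aq_prime_pow_le ha)
  have hEuler := EulerProduct.eulerProduct_hasProd (f := fun q => (Aq a n q).re) h1 hmul hsum h0
  refine ge_of_tendsto hEuler (Filter.Eventually.of_forall fun s => ?_)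
  calc c ≤ ∏ p ∈ s.map ⟨Subtype.val, Subtype.val_injective⟩, localBound p := hprod _
    _ = ∏ p ∈ s, localBound p := Finset.prod_map _ _ _
    _ ≤ ∏ p ∈ s, ∑' k : ℕ, (Aq a n ((p : ℕ) ^ k)).re :=
        Finset.prod_le_prod (fun p _ => (localBound_pos p).le)
          fun p _ => localBound_le_tsum ha han p.2

lemma log_log_three_pos : 0 < Real.log (Real.log 3) := by
  refine Real.log_pos ?_
  rw [Real.lt_log_iff_exp_lt (by norm_num)]
  linarith [Real.exp_one_lt_d9]

lemma log_log_three_mul_inv_le_one {D : ℕ} (hD : 2 ≤ D) :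
    Real.log (Real.log 3) * (Real.log (Real.log D))⁻¹ ≤ 1 := by
  rcases hD.eq_or_lt with rfl | hD3
  · have hlog2 : Real.log (Real.log (2 : ℕ)) ≤ 0 := by
      push_cast
      refine Real.log_nonpos (Real.log_nonneg one_le_two) ?_
      linarith [Real.log_two_lt_d9]
    exact (mul_nonpos_of_nonneg_of_nonpos log_log_three_pos.le (inv_nonpos.2 hlog2)).trans
      zero_le_one
  · have h3 : (3 : ℝ) ≤ D := by exact_mod_cast hD3
    have hle : Real.log (Real.log 3) ≤ Real.log (Real.log D) :=
      Real.log_le_log (Real.log_pos (by norm_num)) (Real.log_le_log (by norm_num) h3)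
    rw [← div_eq_mul_inv]
    exact (div_le_one (log_log_three_pos.trans_le hle)).2 hle

end SingularSeries

/-- There are absolute constants `c, c\' > 0` such that under the stated conditions
the singular series `𝔖(n) = ∑_{q=1}^∞ A(q)` is a real number satisfying
`𝔖(n) ≥ c\'·(log log D)^{−c}`, where `D = max{2, |a₁|, …, |a₉|}`. -/
theorem singular_series_lower_bound :
    ∃ c : ℝ, 0 < c ∧ ∃ c' : ℝ, 0 < c' ∧
      ∀ (a : Fin 9 → ℤ), (∀ j, a j ≠ 0) → ∀ n : ℤ,
        (∑ j, a j) ≡ n [ZMOD 2] →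
        (∀ i j, i ≠ j → IsCoprime (a i) (a j)) →
        (∀ d : ℤ, d ∣ n → (∀ j, d ∣ a j) → IsUnit d) →
        ∃ S : ℝ, (∑' q : ℕ, Aq a n q) = (S : ℂ) ∧
          c' * (Real.log (Real.log
            ((max 2 (Finset.univ.sup fun j => (a j).natAbs) : ℕ) : ℝ))) ^ (-c) ≤ S := by
  obtain ⟨c, hc, hS⟩ := SingularSeries.exists_pos_le_singularSeries
  refine ⟨1, one_pos, c * Real.log (Real.log 3), mul_pos hc SingularSeries.log_log_three_pos, ?_⟩
  intro a _ n han ha _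
  obtain ⟨S, hS_eq, hcS⟩ := hS a n han ha
  refine ⟨S, hS_eq, ?_⟩
  rw [Real.rpow_neg_one, mul_assoc]
  refine le_trans ?_ hcS
  exact mul_le_of_le_one_right hc.le
    (SingularSeries.log_log_three_mul_inv_le_one (le_max_left _ _))
end

section
/- Let a₁,…,a₉ be positive integers with (aᵢ,aⱼ)=1 for 1≤i<j≤9, let 0 < C < 1/9 be a fixed constant, and set M := CN and n := N. Then there are constants 0 < c₁ ≤ c₂ depending only on C such that for all N sufficiently large in terms of a₁,…,a₉, c₁·N²/(a₁⋯a₉)^{1/3} ≤ 𝔍(n) ≤ c₂·N²/(a₁⋯a₉)^{1/3}, where 𝔍(n) := ∑ (m₁⋯m₉)^{−2/3}, the sum over positive integers m₁,…,m₉ with a₁m₁ + ⋯ + a₉m₉ = n and M < a_j m_j ≤ N for every j. -/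
open scoped BigOperators Classical

/-- The singular integral
`𝔍(n) = ∑_{a₁m₁+⋯+a₉m₉ = n, M < a_j m_j ≤ N} (m₁⋯m₉)^{−2/3}` (here `n = N`,
`M = C·N`), the sum being over 9-tuples of positive integers. -/
noncomputable def Jfrak (a : Fin 9 → ℕ) (Cc : ℝ) (N : ℕ) : ℝ :=
  ∑ m ∈ Finset.filter
      (fun m : Fin 9 → ℕ => (∑ j, a j * m j) = N ∧
        ∀ j, Cc * (N : ℝ) < ((a j * m j : ℕ) : ℝ) ∧ a j * m j ≤ N)
      (Finset.Icc 1 fun _ => N),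
    (∏ j, (m j : ℝ)) ^ (-(2 : ℝ) / 3)

lemma card_filter_modEq_le {a b r : ℕ} (hab : a ≤ b) (hr : 0 < r) (v : ℕ) :
    (((Finset.Ioc a b).filter (fun k => k ≡ v [MOD r])).card : ℝ) ≤ ((b : ℝ) - a) / r + 1 := by
  have h := Nat.Ioc_filter_modEq_card a b hr v
  have h1 : (((Finset.Ioc a b).filter (fun k => k ≡ v [MOD r])).card : ℚ) ≤
      ((b : ℚ) - a) / r + 1 := by
    have hab' : (a : ℚ) ≤ b := by exact_mod_cast hab
    have hq : (((Finset.Ioc a b).filter (fun k => k ≡ v [MOD r])).card : ℚ) =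
      ((max (⌊((b : ℚ) - v) / r⌋ - ⌊((a : ℚ) - v) / r⌋) 0 : ℤ) : ℚ) := by exact_mod_cast h
    rw [hq, Int.cast_max]
    refine max_le ?_ (by have : 0 ≤ ((b : ℚ) - a) / r := div_nonneg (by linarith) (by positivity)
                         push_cast; linarith)
    push_cast
    have e1 := Int.floor_le (((b : ℚ) - v) / r)
    have e2 := Int.lt_floor_add_one (((a : ℚ) - v) / r)
    have e3 : ((b : ℚ) - a) / r = ((b : ℚ) - v) / r - ((a : ℚ) - v) / r := by ring
    linarith
  simpa using (Rat.cast_le (K := ℝ)).2 h1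

lemma le_card_filter_modEq (a b : ℕ) {r : ℕ} (hr : 0 < r) (v : ℕ) :
    ((b : ℝ) - a) / r - 1 ≤ (((Finset.Ioc a b).filter (fun k => k ≡ v [MOD r])).card : ℝ) := by
  have h := Nat.Ioc_filter_modEq_card a b hr v
  have h1 : ((b : ℚ) - a) / r - 1 ≤
      (((Finset.Ioc a b).filter (fun k => k ≡ v [MOD r])).card : ℚ) := by
    have hq : (((Finset.Ioc a b).filter (fun k => k ≡ v [MOD r])).card : ℚ) =
      ((max (⌊((b : ℚ) - v) / r⌋ - ⌊((a : ℚ) - v) / r⌋) 0 : ℤ) : ℚ) := by exact_mod_cast h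
    rw [hq, Int.cast_max]
    refine le_max_of_le_left ?_
    push_cast
    have e1 := Int.lt_floor_add_one (((b : ℚ) - v) / r)
    have e2 := Int.floor_le (((a : ℚ) - v) / r)
    have e3 : ((b : ℚ) - a) / r = ((b : ℚ) - v) / r - ((a : ℚ) - v) / r := by ring
    linarith
  simpa using (Rat.cast_le (K := ℝ)).2 h1

lemma rpow_neg_two_thirds {X A : ℝ} (hX : 0 < X) (hA : 0 < A) :
    (X ^ 9 / A) ^ (-(2 : ℝ) / 3) = A / (X ^ 6 * A ^ ((1 : ℝ) / 3)) := by
  rw [Real.div_rpow (by positivity) hA.le, ← Real.rpow_natCast X 9, ← Real.rpow_mul hX.le]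
  have h1 : ((9 : ℕ) : ℝ) * (-(2 : ℝ) / 3) = -((6 : ℕ) : ℝ) := by norm_num
  rw [h1, Real.rpow_neg hX.le, Real.rpow_natCast]
  have h2 : A ^ (-(2 : ℝ) / 3) * A = A ^ ((1 : ℝ) / 3) := by
    conv_lhs => rw [← Real.rpow_one A]
    rw [← Real.rpow_mul hA.le, ← Real.rpow_add hA]
    norm_num
  rw [← h2]
  have : 0 < A ^ (-(2 : ℝ) / 3) := Real.rpow_pos_of_pos hA _
  field_simp

/-- The tuples over which `Jfrak` sums. -/
noncomputable def solutions (a : Fin 9 → ℕ) (Cc : ℝ) (N : ℕ) : Finset (Fin 9 → ℕ) :=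
  Finset.filter
      (fun m : Fin 9 → ℕ => (∑ j, a j * m j) = N ∧
        ∀ j, Cc * (N : ℝ) < ((a j * m j : ℕ) : ℝ) ∧ a j * m j ≤ N)
      (Finset.Icc 1 fun _ => N)

lemma mem_solutions {a : Fin 9 → ℕ} {Cc : ℝ} (hC : 0 < Cc) {N : ℕ} (ha : ∀ j, 0 < a j)
    {m : Fin 9 → ℕ} : m ∈ solutions a Cc N ↔
      (∑ j, a j * m j) = N ∧ ∀ j, Cc * (N : ℝ) < ((a j * m j : ℕ) : ℝ) := by
  unfold solutions
  rw [Finset.mem_filter, Finset.mem_Icc]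
  refine ⟨fun h => ⟨h.2.1, fun j => (h.2.2 j).1⟩, fun h => ?_⟩
  have hle : ∀ j, a j * m j ≤ N := fun j => by
    rw [← h.1]
    exact Finset.single_le_sum (f := fun j => a j * m j) (fun _ _ => Nat.zero_le _)
      (Finset.mem_univ j)
  refine ⟨⟨fun j => ?_, fun j => (Nat.le_mul_of_pos_left _ (ha j)).trans (hle j)⟩,
    h.1, fun j => ⟨h.2 j, hle j⟩⟩
  have h0 : (0 : ℝ) < ((a j * m j : ℕ) : ℝ) := lt_of_le_of_lt (by positivity) (h.2 j)
  have h1 : 0 < a j * m j := by exact_mod_cast h0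
  exact Nat.pos_of_mul_pos_left h1

lemma prod_univ_nine {M : Type*} [CommMonoid M] (f : Fin 9 → M) :
    ∏ j, f j = f 0 * f 1 * ∏ i : Fin 7, f i.succ.succ := by
  rw [Fin.prod_univ_succ, Fin.prod_univ_succ, mul_assoc]
  rfl

lemma sum_univ_nine (f : Fin 9 → ℕ) :
    ∑ j, f j = f 0 + f 1 + ∑ i : Fin 7, f i.succ.succ := by
  rw [Fin.sum_univ_succ, Fin.sum_univ_succ, add_assoc]
  rfl

lemma card_solutions_le {a : Fin 9 → ℕ} {Cc : ℝ} (hC : 0 < Cc) {N : ℕ} (ha : ∀ j, 0 < a j)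
    (hcop : Nat.Coprime (a 0) (a 1)) (hN : a 0 * a 1 ≤ N) :
    ((solutions a Cc N).card : ℝ) ≤ 2 * (N : ℝ) ^ 8 / ∏ j, (a j : ℝ) := by
  have ha' : ∀ j, (0 : ℝ) < a j := fun j => by exact_mod_cast ha j
  set T : Finset (Fin 7 → ℕ) :=
    Fintype.piFinset fun i => Finset.Ioc 0 (N / a i.succ.succ) with hT
  set f : (Fin 9 → ℕ) → (Fin 7 → ℕ) := fun m i => m i.succ.succ with hf
  have hpos : ∀ m ∈ solutions a Cc N, ∀ j, m j ∈ Finset.Ioc 0 (N / a j) := by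
    intro m hm j
    have h := Finset.mem_filter.1 hm
    have h1 := (Finset.mem_Icc.1 h.1).1 j
    refine Finset.mem_Ioc.2 ⟨h1, ?_⟩
    rw [Nat.le_div_iff_mul_le (ha j), mul_comm]
    exact (h.2.2 j).2
  have hmaps : ∀ m ∈ solutions a Cc N, f m ∈ T := fun m hm =>
    Fintype.mem_piFinset.2 fun i => hpos m hm _
  have hfib : ∀ t ∈ T, (((solutions a Cc N).filter (fun m => f m = t)).card : ℝ) ≤
      2 * N / (a 0 * a 1) := by
    intro t _
    have hNR : (a 0 * a 1 : ℝ) ≤ N := by exact_mod_cast hN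
    rcases ((solutions a Cc N).filter (fun m => f m = t)).eq_empty_or_nonempty with h0 | ⟨m', hm'⟩
    · rw [h0]; simp; have := ha' 0; have := ha' 1; positivity
    · have hcard : ((solutions a Cc N).filter (fun m => f m = t)).card ≤
          ((Finset.Ioc 0 (N / a 0)).filter (fun k => k ≡ m' 0 [MOD a 1])).card := by
        have key : ∀ m ∈ (solutions a Cc N).filter (fun m => f m = t),
            a 0 * m 0 + a 1 * m 1 + ∑ i : Fin 7, a i.succ.succ * t i = N := by
          intro m hm
          obtain ⟨hm1, hm2⟩ := Finset.mem_filter.1 hm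
          have h := ((mem_solutions hC ha).1 hm1).1
          rw [sum_univ_nine, ← h] at *
          subst hm2
          rfl
        refine Finset.card_le_card_of_injOn (fun m => m 0) ?_ ?_
        · intro m hm
          have hk := key m hm
          have hk' := key m' hm'
          refine Finset.mem_coe.2 (Finset.mem_filter.2
            ⟨hpos m (Finset.mem_filter.1 hm).1 0, ?_⟩)
          have e : a 0 * m 0 ≡ a 0 * m' 0 [MOD a 1] := by
            have e1 : a 0 * m 0 + a 1 * m 1 = a 0 * m' 0 + a 1 * m' 1 := by omega
            have e2 := congrArg (· % a 1) e1
            simpa [Nat.ModEq, Nat.add_mul_mod_self_left] using e2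
          exact Nat.ModEq.cancel_left_of_coprime hcop.symm e
        · intro m hm n hn hmn
          have hk := key m hm
          have hk' := key n hn
          have h0 : m 0 = n 0 := hmn
          rw [h0] at hk
          have h1 : m 1 = n 1 := Nat.eq_of_mul_eq_mul_left (ha 1) (by omega)
          have h2 : f m = f n :=
            (Finset.mem_filter.1 hm).2.trans (Finset.mem_filter.1 hn).2.symm
          funext j
          refine Fin.cases h0 (fun j => Fin.cases h1 (fun i => congrFun h2 i) j) j
      have h2 := card_filter_modEq_le (Nat.zero_le (N / a 0)) (ha 1) (m' 0)
      have h3 : ((N / a 0 : ℕ) : ℝ) ≤ N / a 0 := Nat.cast_div_le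
      have h4 : ((N / a 0 : ℕ) : ℝ) / a 1 ≤ N / a 0 / a 1 :=
        div_le_div_of_nonneg_right h3 (ha' 1).le
      have h5 : (1 : ℝ) ≤ N / (a 0 * a 1) := by
        rw [le_div_iff₀ (mul_pos (ha' 0) (ha' 1))]; linarith
      have h6 : (((solutions a Cc N).filter (fun m => f m = t)).card : ℝ) ≤ _ :=
        Nat.cast_le.2 hcard
      have h7 : (N : ℝ) / a 0 / a 1 = N / (a 0 * a 1) := div_div _ _ _
      have h8 : 2 * (N : ℝ) / (a 0 * a 1) = N / (a 0 * a 1) + N / (a 0 * a 1) := by ring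
      rw [Nat.cast_zero, sub_zero] at h2
      linarith
  have hTcard : (T.card : ℝ) ≤ (N : ℝ) ^ 7 / ∏ i : Fin 7, (a i.succ.succ : ℝ) := by
    rw [hT, Fintype.card_piFinset]
    push_cast
    have : (N : ℝ) ^ 7 / ∏ i : Fin 7, (a i.succ.succ : ℝ) =
        ∏ i : Fin 7, (N : ℝ) / (a i.succ.succ : ℝ) := by
      rw [Finset.prod_div_distrib]; simp
    rw [this]
    refine Finset.prod_le_prod (fun _ _ => by positivity) fun i _ => ?_
    simpa using (Nat.cast_div_le : ((N / a i.succ.succ : ℕ) : ℝ) ≤ _)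
  have hsum := Finset.card_eq_sum_card_fiberwise hmaps
  calc ((solutions a Cc N).card : ℝ)
      = ∑ t ∈ T, (((solutions a Cc N).filter (fun m => f m = t)).card : ℝ) := by
        exact_mod_cast hsum
    _ ≤ ∑ t ∈ T, 2 * (N : ℝ) / (a 0 * a 1) := Finset.sum_le_sum hfib
    _ = T.card * (2 * (N : ℝ) / (a 0 * a 1)) := by rw [Finset.sum_const, nsmul_eq_mul]
    _ ≤ (N : ℝ) ^ 7 / (∏ i : Fin 7, (a i.succ.succ : ℝ)) * (2 * (N : ℝ) / (a 0 * a 1)) := by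
        gcongr
    _ = 2 * (N : ℝ) ^ 8 / ∏ j, (a j : ℝ) := by
        rw [prod_univ_nine, div_mul_div_comm]
        congr 1 <;> ring

lemma le_card_solutions {a : Fin 9 → ℕ} {Cc η : ℝ} (hC : 0 < Cc) {N : ℕ} (ha : ∀ j, 0 < a j)
    (hcop : Nat.Coprime (a 0) (a 1)) (hη : 0 < η) (hCη : 9 * Cc + 9 * η ≤ 1)
    (hN : ∀ j, 2 * (a j : ℝ) ≤ η * N) (hN' : 4 * (a 0 * a 1 : ℝ) ≤ η * N) :
    (η / 2) ^ 8 * (N : ℝ) ^ 8 / ∏ j, (a j : ℝ) ≤ ((solutions a Cc N).card : ℝ) := by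
  have ha' : ∀ j, (0 : ℝ) < a j := fun j => by exact_mod_cast ha j
  have hNpos : (0 : ℝ) < N := by
    have := hN 0; have := ha' 0
    by_contra! h
    nlinarith
  set lo : Fin 9 → ℕ := fun j => ⌊Cc * N / a j⌋₊ with hlo
  set hi : Fin 9 → ℕ := fun j => ⌊(Cc + η) * N / a j⌋₊ with hhi
  have hmem : ∀ j k, k ∈ Finset.Ioc (lo j) (hi j) →
      Cc * N < (a j * k : ℝ) ∧ (a j * k : ℝ) ≤ (Cc + η) * N := by
    intro j k hk
    obtain ⟨h1, h2⟩ := Finset.mem_Ioc.1 hk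
    have h1' := (Nat.floor_lt (by positivity)).1 h1
    have h2' := (Nat.le_floor_iff (by positivity)).1 h2
    rw [div_lt_iff₀ (ha' j)] at h1'
    rw [le_div_iff₀ (ha' j)] at h2'
    constructor <;> linarith
  have hlen : ∀ j, η * N / a j - 1 ≤ (hi j : ℝ) - lo j := by
    intro j
    have h1 := Nat.lt_floor_add_one ((Cc + η) * N / (a j : ℝ))
    have h2 : (lo j : ℝ) ≤ Cc * N / a j := Nat.floor_le (by positivity)
    have h3 : (Cc + η) * N / (a j : ℝ) = Cc * N / a j + η * N / a j := by ring
    change _ ≤ (⌊(Cc + η) * N / (a j : ℝ)⌋₊ : ℝ) - _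
    linarith
  set T : Finset (Fin 7 → ℕ) :=
    Fintype.piFinset fun i => Finset.Ioc (lo i.succ.succ) (hi i.succ.succ) with hT
  set f : (Fin 9 → ℕ) → (Fin 7 → ℕ) := fun m i => m i.succ.succ with hf
  have hfib : ∀ t ∈ T, η / 2 * N / (a 0 * a 1) ≤
      (((solutions a Cc N).filter (fun m => f m = t)).card : ℝ) := by
    intro t ht
    have htm : ∀ i, Cc * N < (a i.succ.succ * t i : ℝ) ∧
        (a i.succ.succ * t i : ℝ) ≤ (Cc + η) * N := fun i =>
      hmem _ _ (Fintype.mem_piFinset.1 ht i)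
    set s : ℕ := ∑ i : Fin 7, a i.succ.succ * t i with hs
    have hsle : (s : ℝ) ≤ 7 * ((Cc + η) * N) := by
      rw [hs]; push_cast
      refine (Finset.sum_le_sum fun i _ => (htm i).2).trans ?_
      simp
    have hbd : ∀ k ∈ Finset.Ioc (lo 0) (hi 0), Cc * N < (N : ℝ) - s - a 0 * k := by
      intro k hk
      have := (hmem 0 k hk).2
      have : (9 * Cc + 9 * η) * N ≤ 1 * N := by gcongr
      have : 0 < η * N := by positivity
      linarith
    have hsN : s ≤ N := by
      have : (s : ℝ) ≤ N := by
        have : (9 * Cc + 9 * η) * N ≤ 1 * N := by gcongr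
        have : 0 < η * N := by positivity
        have : 0 < Cc * N := by positivity
        linarith
      exact_mod_cast this
    obtain ⟨v', hv1, hv2⟩ := Nat.chineseRemainder hcop 0 (N - s)
    obtain ⟨v, rfl⟩ := (Nat.modEq_zero_iff_dvd).1 hv1
    have hcard : ((Finset.Ioc (lo 0) (hi 0)).filter (fun k => k ≡ v [MOD a 1])).card ≤
        ((solutions a Cc N).filter (fun m => f m = t)).card := by
      refine Finset.card_le_card_of_injOn
        (fun k => Fin.cons k (Fin.cons ((N - s - a 0 * k) / a 1) t)) ?_ ?_
      · intro k hk
        obtain ⟨hk1, hk2⟩ := Finset.mem_filter.1 (Finset.mem_coe.1 hk)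
        have hb := hbd k hk1
        have hle : a 0 * k ≤ N - s := by
          have : ((a 0 * k + s : ℕ) : ℝ) ≤ N := by
            push_cast
            have : 0 < Cc * N := by positivity
            linarith
          have : a 0 * k + s ≤ N := by exact_mod_cast this
          omega
        have hdvd : a 1 ∣ N - s - a 0 * k :=
          (Nat.modEq_iff_dvd' hle).1 ((hk2.mul_left (a 0)).trans hv2)
        have hdiv : a 1 * ((N - s - a 0 * k) / a 1) = N - s - a 0 * k := Nat.mul_div_cancel' hdvd
        refine Finset.mem_coe.2 (Finset.mem_filter.2 ⟨(mem_solutions hC ha).2 ⟨?_, ?_⟩, ?_⟩)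
        · rw [sum_univ_nine]
          change a 0 * k + a 1 * ((N - s - a 0 * k) / a 1) + s = N
          omega
        · intro j
          refine Fin.cases ?_ (fun j => Fin.cases ?_ (fun i => ?_) j) j
          · simpa using (hmem 0 k hk1).1
          · change _ < ((a 1 * ((N - s - a 0 * k) / a 1) : ℕ) : ℝ)
            rw [hdiv, Nat.cast_sub hle, Nat.cast_sub hsN]
            push_cast
            exact hb
          · simpa using (htm i).1
        · rfl
      · intro k _ l _ hkl
        exact congrFun hkl 0
    have h2 := le_card_filter_modEq (lo 0) (hi 0) (ha 1) v
    have h6 : _ ≤ (((solutions a Cc N).filter (fun m => f m = t)).card : ℝ) :=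
      Nat.cast_le.2 hcard
    refine le_trans ?_ (h2.trans h6)
    have h3 : (η * N / a 0 - 1) / a 1 ≤ ((hi 0 : ℝ) - lo 0) / a 1 :=
      div_le_div_of_nonneg_right (hlen 0) (ha' 1).le
    have h4 : (1 : ℝ) / a 1 ≤ 1 := by
      rw [div_le_one (ha' 1)]; exact_mod_cast ha 1
    have h5 : (2 : ℝ) ≤ η / 2 * N / (a 0 * a 1) := by
      rw [le_div_iff₀ (mul_pos (ha' 0) (ha' 1))]; linarith
    have h7 : (η * N / a 0 - 1) / a 1 = 2 * (η / 2 * N / (a 0 * a 1)) - 1 / a 1 := by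
      have := (ha' 0).ne'; have := (ha' 1).ne'; field_simp
    linarith
  have hTcard : (η / 2) ^ 7 * (N : ℝ) ^ 7 / ∏ i : Fin 7, (a i.succ.succ : ℝ) ≤ (T.card : ℝ) := by
    rw [hT, Fintype.card_piFinset]
    push_cast
    have : (η / 2) ^ 7 * (N : ℝ) ^ 7 / ∏ i : Fin 7, (a i.succ.succ : ℝ) =
        ∏ i : Fin 7, (η / 2 * N) / (a i.succ.succ : ℝ) := by
      rw [Finset.prod_div_distrib, Finset.prod_const, ← mul_pow]; simp
    rw [this]
    refine Finset.prod_le_prod (fun i _ => by positivity) fun i _ => ?_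
    rw [Nat.card_Ioc]
    have h1 := hlen i.succ.succ
    have h2 : (1 : ℝ) ≤ η / 2 * N / a i.succ.succ := by
      rw [le_div_iff₀ (ha' _)]; linarith [hN i.succ.succ]
    have h3 : η * N / a i.succ.succ = 2 * (η / 2 * N / a i.succ.succ) := by ring
    have h4 : (hi i.succ.succ : ℝ) ≤ ((hi i.succ.succ - lo i.succ.succ : ℕ) : ℝ) +
        lo i.succ.succ := by exact_mod_cast le_tsub_add
    linarith
  calc (η / 2) ^ 8 * (N : ℝ) ^ 8 / ∏ j, (a j : ℝ)
      = (η / 2) ^ 7 * (N : ℝ) ^ 7 / (∏ i : Fin 7, (a i.succ.succ : ℝ)) *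
          (η / 2 * N / (a 0 * a 1)) := by
        rw [prod_univ_nine, div_mul_div_comm]
        congr 1 <;> ring
    _ ≤ T.card * (η / 2 * N / (a 0 * a 1)) := by gcongr
    _ = ∑ t ∈ T, η / 2 * N / (a 0 * a 1) := by rw [Finset.sum_const, nsmul_eq_mul]
    _ ≤ ∑ t ∈ T, (((solutions a Cc N).filter (fun m => f m = t)).card : ℝ) :=
        Finset.sum_le_sum hfib
    _ ≤ ((solutions a Cc N).card : ℝ) := by
        have h := Finset.sum_card_fiberwise_eq_card_filter (solutions a Cc N) T f
        have h' := h.le.trans (Finset.card_filter_le _ _)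
        exact_mod_cast h'

lemma term_bounds {a : Fin 9 → ℕ} {Cc : ℝ} (hC : 0 < Cc) {N : ℕ} (hN : 0 < N)
    (ha : ∀ j, 0 < a j) {m : Fin 9 → ℕ} (hm : m ∈ solutions a Cc N) :
    (∏ j, (a j : ℝ)) / ((N : ℝ) ^ 6 * (∏ j, (a j : ℝ)) ^ ((1 : ℝ) / 3)) ≤
        (∏ j, (m j : ℝ)) ^ (-(2 : ℝ) / 3) ∧
      (∏ j, (m j : ℝ)) ^ (-(2 : ℝ) / 3) ≤
        (∏ j, (a j : ℝ)) / ((Cc * N) ^ 6 * (∏ j, (a j : ℝ)) ^ ((1 : ℝ) / 3)) := by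
  have hNR : (0 : ℝ) < N := by exact_mod_cast hN
  have hA : 0 < ∏ j, (a j : ℝ) := Finset.prod_pos fun j _ => by exact_mod_cast ha j
  have h := (Finset.mem_filter.1 hm).2.2
  have hlow : (Cc * N) ^ 9 ≤ (∏ j, (m j : ℝ)) * ∏ j, (a j : ℝ) := by
    rw [← Finset.prod_mul_distrib]
    calc (Cc * (N : ℝ)) ^ 9 = ∏ _j : Fin 9, Cc * (N : ℝ) := by simp
      _ ≤ _ := Finset.prod_le_prod (fun _ _ => by positivity) fun j _ => by
        have := (h j).1.le
        push_cast at this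
        linarith
  have hupp : (∏ j, (m j : ℝ)) * ∏ j, (a j : ℝ) ≤ (N : ℝ) ^ 9 := by
    rw [← Finset.prod_mul_distrib]
    calc _ ≤ ∏ _j : Fin 9, (N : ℝ) := Finset.prod_le_prod (fun _ _ => by positivity) fun j _ => by
          have : ((a j * m j : ℕ) : ℝ) ≤ N := by exact_mod_cast (h j).2
          push_cast at this
          linarith
      _ = _ := by simp
  have hlow' := (div_le_iff₀ hA).2 hlow
  rw [← rpow_neg_two_thirds hNR hA, ← rpow_neg_two_thirds (mul_pos hC hNR) hA]
  refine ⟨Real.rpow_le_rpow_of_nonpos (lt_of_lt_of_le (by positivity) hlow')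
    ((le_div_iff₀ hA).2 hupp) (by norm_num),
    Real.rpow_le_rpow_of_nonpos (by positivity) hlow' (by norm_num)⟩

/-- For positive pairwise coprime `a₁,…,a₉`, `0 < C < 1/9`, `M = CN` and `n = N`:
there are constants `0 < c₁ ≤ c₂` depending only on `C` with
`c₁ N²/(a₁⋯a₉)^{1/3} ≤ 𝔍(n) ≤ c₂ N²/(a₁⋯a₉)^{1/3}` for all sufficiently large `N`. -/
theorem Jfrak_asymp :
    ∀ Cc : ℝ, 0 < Cc → Cc < 1 / 9 →
    ∃ c₁ c₂ : ℝ, 0 < c₁ ∧ c₁ ≤ c₂ ∧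
      ∀ (a : Fin 9 → ℕ), (∀ j, 0 < a j) →
        (∀ i j, i ≠ j → Nat.Coprime (a i) (a j)) →
        ∃ N₀ : ℕ, ∀ N : ℕ, N₀ ≤ N →
          c₁ * (N : ℝ) ^ 2 / (∏ j, (a j : ℝ)) ^ ((1 : ℝ) / 3) ≤ Jfrak a Cc N ∧
          Jfrak a Cc N ≤ c₂ * (N : ℝ) ^ 2 / (∏ j, (a j : ℝ)) ^ ((1 : ℝ) / 3) := by
  intro Cc hC hC9
  set η : ℝ := (1 - 9 * Cc) / 9 with hη
  have hη0 : 0 < η := by rw [hη]; linarith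
  have hη1 : η ≤ 1 := by rw [hη]; linarith
  refine ⟨(η / 2) ^ 8, 2 / Cc ^ 6, by positivity, ?_, fun a ha hcop => ?_⟩
  · have h1 : (η / 2) ^ 8 ≤ 1 := pow_le_one₀ (by positivity) (by linarith)
    have h2 : Cc ^ 6 ≤ 1 := pow_le_one₀ hC.le (by linarith)
    have h3 : (1 : ℝ) ≤ 2 / Cc ^ 6 := by rw [le_div_iff₀ (by positivity)]; linarith
    linarith
  have hcop01 : Nat.Coprime (a 0) (a 1) := hcop 0 1 (by decide)
  set K : ℕ := 4 * (a 0 * a 1) + 2 * ∑ j, a j with hK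
  refine ⟨⌈(K : ℝ) / η⌉₊ + K + 1, fun N hN => ?_⟩
  have hKN : (K : ℝ) ≤ η * N := by
    have h1 : (K : ℝ) / η ≤ N := (Nat.le_ceil _).trans (by exact_mod_cast (by omega))
    rw [div_le_iff₀ hη0] at h1
    linarith
  have hNpos : 0 < N := by omega
  have hNR : (0 : ℝ) < N := by exact_mod_cast hNpos
  have hA : 0 < ∏ j, (a j : ℝ) := Finset.prod_pos fun j _ => by exact_mod_cast ha j
  have hj : ∀ j, 2 * (a j : ℝ) ≤ η * N := fun j => by
    refine le_trans ?_ hKN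
    have : a j ≤ ∑ j, a j :=
      Finset.single_le_sum (f := a) (fun _ _ => Nat.zero_le _) (Finset.mem_univ j)
    exact_mod_cast (by omega : 2 * a j ≤ K)
  have h01 : 4 * (a 0 * a 1 : ℝ) ≤ η * N := by
    refine le_trans ?_ hKN
    exact_mod_cast (by omega : 4 * (a 0 * a 1) ≤ K)
  have hlow := le_card_solutions hC ha hcop01 hη0 (by rw [hη]; linarith) hj h01
  have hupp := card_solutions_le hC ha hcop01 (by omega : a 0 * a 1 ≤ N)
  have hJ : Jfrak a Cc N = ∑ m ∈ solutions a Cc N, (∏ j, (m j : ℝ)) ^ (-(2 : ℝ) / 3) := rfl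
  have hterm := fun m hm => term_bounds hC hNpos ha (m := m) hm
  have hA3 : 0 < (∏ j, (a j : ℝ)) ^ ((1 : ℝ) / 3) := Real.rpow_pos_of_pos hA _
  have h1 := Finset.card_nsmul_le_sum _ _ _ fun m hm => (hterm m hm).1
  have h2 := Finset.sum_le_card_nsmul _ _ _ fun m hm => (hterm m hm).2
  rw [nsmul_eq_mul, ← hJ] at h1 h2
  constructor
  · refine le_trans ?_ h1
    refine le_trans (le_of_eq ?_) (mul_le_mul_of_nonneg_right hlow (by positivity))
    field_simp
  · refine h2.trans ?_
    refine (mul_le_mul_of_nonneg_right hupp (by positivity)).trans (le_of_eq ?_)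
    field_simp
end
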